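/- arXiv:1206.4839 — 5 statements merged into one kernel-verified Lean document; each statement's English description precedes it below -/
import Mathlib

section
/- Let X and E be finite-dimensional real normed spaces and let f : S_X → S_E be a bijective isometry between their unit spheres. Then f(−x) = −f(x) for every x ∈ S_X. -/
open Filter Topology Metric Set MeasureTheory

noncomputable section

/-- The normalized direction `v / ‖v‖` of a vector (equal to `0` when `v = 0`). -/
def unitDir {X : Type*} [NormedAddCommGroup X] [NormedSpace ℝ X] (v : X) : X := ‖v‖⁻¹ • v

/-- The set `ℷ(x)` of support functionals at a point `x` of the unit sphere:
functionals of norm one attaining the value `1` at `x`. -/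
def suppFn (X : Type*) [NormedAddCommGroup X] [NormedSpace ℝ X] (x : X) :
    Set (X →L[ℝ] ℝ) := {g | ‖g‖ = 1 ∧ g x = 1}

/-- A point of the unit sphere is smooth if it has exactly one support functional. -/
def IsSmoothPt {X : Type*} [NormedAddCommGroup X] [NormedSpace ℝ X] (x : X) : Prop :=
  ∃ g : X →L[ℝ] ℝ, suppFn X x = {g}

/-- `D_y = {x ∈ S_X : ‖x + y‖ < 2}`. -/
def Dset {X : Type*} [NormedAddCommGroup X] [NormedSpace ℝ X] (y : X) : Set X :=
  {x | x ∈ sphere (0 : X) 1 ∧ ‖x + y‖ < 2}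

/-- `W_y`: points `x ∈ D_y` with `(x-y)/‖x-y‖` smooth in `X` and
`(f x - f y)/‖f x - f y‖` smooth in `E`. -/
def Wset {X E : Type*} [NormedAddCommGroup X] [NormedSpace ℝ X]
    [NormedAddCommGroup E] [NormedSpace ℝ E] (f : X → E) (y : X) : Set X :=
  {x | x ∈ Dset y ∧ IsSmoothPt (unitDir (x - y)) ∧ IsSmoothPt (unitDir (f x - f y))}

/-- `Λ_y`: the set of limit points of `(y - z)/‖y - z‖` as `z → y`, `z ∈ S_X`, `z ≠ y`. -/
def tangentDirs {X : Type*} [NormedAddCommGroup X] [NormedSpace ℝ X] (y : X) : Set X :=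
  {u | ∃ z : ℕ → X, (∀ n, z n ∈ sphere (0 : X) 1 ∧ z n ≠ y) ∧
    Tendsto z atTop (𝓝 y) ∧ Tendsto (fun n => unitDir (y - z n)) atTop (𝓝 u)}

/-- A linear map `T` represents the tangent action of `f` at `y`: whenever `y_n → y` on the
sphere with `(y - y_n)/‖y - y_n‖ → u`, one has `(f y - f y_n)/‖f y - f y_n‖ → T u`. -/
def RepTangent {X E : Type*} [NormedAddCommGroup X] [NormedSpace ℝ X]
    [NormedAddCommGroup E] [NormedSpace ℝ E] (f : X → E) (y : X) (T : X →ₗ[ℝ] E) : Prop :=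
  ∀ (z : ℕ → X) (u : X), (∀ n, z n ∈ sphere (0 : X) 1 ∧ z n ≠ y) →
    Tendsto z atTop (𝓝 y) → Tendsto (fun n => unitDir (y - z n)) atTop (𝓝 u) →
    Tendsto (fun n => unitDir (f y - f (z n))) atTop (𝓝 (T u))

/-- The positively homogeneous extension `F` of `f`: `F 0 = 0`, `F x = ‖x‖ • f (x/‖x‖)`. -/
def homExt {X E : Type*} [NormedAddCommGroup X] [NormedSpace ℝ X]
    [NormedAddCommGroup E] [NormedSpace ℝ E] (f : X → E) (x : X) : E :=
  ‖x‖ • f (unitDir x)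

/-- `F` is Gateaux differentiable at `y`: all one-sided directional derivatives exist and
depend linearly (and continuously) on the direction. -/
def GateauxAt {X E : Type*} [NormedAddCommGroup X] [NormedSpace ℝ X]
    [NormedAddCommGroup E] [NormedSpace ℝ E] (F : X → E) (y : X) : Prop :=
  ∃ L : X →L[ℝ] E, ∀ z : X,
    Tendsto (fun a : ℝ => a⁻¹ • (F (y + a • z) - F y)) (𝓝[>] 0) (𝓝 (L z))

/-- In finite dimension the convex hull of a compact set is compact. -/
theorem IsCompact.convexHull_of_finiteDimensional {X : Type*} [NormedAddCommGroup X]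
    [NormedSpace ℝ X] [FiniteDimensional ℝ X] {A : Set X} (hA : IsCompact A) :
    IsCompact (convexHull ℝ A) := by
  have key : convexHull ℝ A = ⋃ n ∈ Finset.range (Module.finrank ℝ X + 2),
      (fun p : (Fin n → ℝ) × (Fin n → X) => ∑ i, p.1 i • p.2 i) ''
        (stdSimplex ℝ (Fin n) ×ˢ Set.univ.pi fun _ => A) := by
    refine Set.Subset.antisymm (fun x hx => ?_) ?_
    · obtain ⟨ι, _, z, w, hz, hind, hw, hsum, rfl⟩ := eq_pos_convex_span_of_mem_convexHull hx
      let e := (Fintype.equivFin ι).symm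
      simp only [Set.mem_iUnion]
      refine ⟨Fintype.card ι, ?_, ⟨w ∘ e, z ∘ e⟩, ⟨⟨fun i => (hw _).le, ?_⟩, ?_⟩, ?_⟩
      · have := hind.card_le_finrank_succ
        have := Submodule.finrank_le (vectorSpan ℝ (Set.range z))
        simp only [Finset.mem_range]
        omega
      · rw [← hsum]
        exact e.sum_comp w
      · exact fun i _ => hz ⟨_, rfl⟩
      · exact e.sum_comp fun i => w i • z i
    · simp only [Set.iUnion_subset_iff]
      rintro n - _ ⟨⟨w, z⟩, ⟨⟨hw, hsum⟩, hz⟩, rfl⟩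
      exact (convex_convexHull ℝ A).sum_mem (fun i _ => hw i) hsum
        fun i _ => subset_convexHull ℝ A (hz i trivial)
  rw [key]
  refine (Finset.range _).isCompact_biUnion fun n _ => ?_
  refine ((isCompact_stdSimplex ℝ (Fin n)).prod (isCompact_univ_pi fun _ => hA)).image ?_
  fun_prop

/-- Near every extreme point of a compact convex set there is an exposed point. -/
theorem exists_exposed_near_extremePoint {X : Type*} [NormedAddCommGroup X]
    [NormedSpace ℝ X] [FiniteDimensional ℝ X] {K : Set X} (hK : IsCompact K) (hconv : Convex ℝ K)
    {x : X} (hx : x ∈ K.extremePoints ℝ) {U : Set X} (hU : IsOpen U) (hxU : x ∈ U) :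
    ∃ x' ∈ K ∩ U, ∃ l : X →ₗ[ℝ] ℝ, ∀ y ∈ K, y ≠ x' → l y < l x' := by
  have hA : IsCompact (K \ U) := hK.diff hU
  have hAK : convexHull ℝ (K \ U) ⊆ K := convexHull_min sdiff_subset hconv
  have hxA : x ∉ convexHull ℝ (K \ U) := fun h =>
    (extremePoints_convexHull_subset
      (inter_extremePoints_subset_extremePoints_of_subset hAK ⟨h, hx⟩)).2 hxU
  obtain ⟨φ, α, hα, hαx⟩ := geometric_hahn_banach_closed_point (convex_convexHull ℝ _)
    hA.convexHull_of_finiteDimensional.isClosed hxA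
  let T := toEuclidean (E := X)
  obtain ⟨M, hM⟩ := hK.exists_bound_of_continuousOn (f := fun y => ‖T (y - x)‖ ^ 2)
    (by fun_prop)
  obtain ⟨R, hR⟩ : ∃ R : ℝ, M < R * (φ x - α) :=
    ⟨(M + 1) / (φ x - α), by rw [div_mul_cancel₀ _ (sub_pos.2 hαx).ne']; linarith⟩
  have hM0 : 0 ≤ M := (norm_nonneg _).trans (hM x hx.1)
  have hR0 : 0 < R := by
    by_contra! h
    nlinarith
  obtain ⟨x', hx', hmax⟩ := hK.exists_isMaxOn (f := fun y => R * φ y + ‖T (y - x)‖ ^ 2)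
    ⟨x, hx.1⟩ (by fun_prop)
  refine ⟨x', ⟨hx', ?_⟩, R • φ.toLinearMap + 2 • (innerₗ _ (T (x' - x))) ∘ₗ T.toLinearMap, ?_⟩
  · by_contra hxU'
    have h1 := hα x' (subset_convexHull ℝ _ ⟨hx', hxU'⟩)
    have h2 : R * φ x + ‖T (x - x)‖ ^ 2 ≤ R * φ x' + ‖T (x' - x)‖ ^ 2 := hmax hx.1
    have h3 := (le_abs_self _).trans (hM x' hx')
    simp only [sub_self, map_zero, norm_zero] at h2
    nlinarith
  · intro y hy hne
    have h2 : R * φ y + ‖T (y - x)‖ ^ 2 ≤ R * φ x' + ‖T (x' - x)‖ ^ 2 := hmax hy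
    have h3 : ‖T (y - x)‖ ^ 2 = ‖T (x' - x)‖ ^ 2 + 2 * inner ℝ (T (x' - x)) (T (y - x'))
        + ‖T (y - x')‖ ^ 2 := by
      rw [← norm_add_sq_real, ← map_add]
      congr 3
      abel
    have h4 : 0 < ‖T (y - x')‖ ^ 2 := by
      have : T (y - x') ≠ 0 := by simpa [sub_eq_zero] using hne
      positivity
    rw [map_sub T y x'] at h3 h4
    rw [inner_sub_right] at h3
    simp only [LinearMap.add_apply, LinearMap.smul_apply, LinearMap.comp_apply, smul_eq_mul,
      nsmul_eq_mul, Nat.cast_ofNat, innerₗ_apply_apply]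
    change R * φ y + 2 * inner ℝ _ (T y) < R * φ x' + 2 * inner ℝ _ (T x')
    linarith

/-- The directions in which one can move a little both ways from `x` inside the convex set `A`. -/
def faceDir {X : Type*} [NormedAddCommGroup X] [NormedSpace ℝ X] {A : Set X}
    (hA : Convex ℝ A) {x : X} (hx : x ∈ A) : Submodule ℝ X where
  carrier := {w | ∀ᶠ t : ℝ in 𝓝 0, x + t • w ∈ A}
  zero_mem' := by simp [hx]
  add_mem' := by
    intro v w hv hw
    have h2 : Tendsto (fun t : ℝ => 2 * t) (𝓝 0) (𝓝 0) := by
      have : Continuous (fun t : ℝ => 2 * t) := by fun_prop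
      simpa using this.tendsto 0
    filter_upwards [h2.eventually hv, h2.eventually hw] with t hv hw
    convert hA hv hw (a := 1 / 2) (b := 1 / 2) (by norm_num) (by norm_num) (by norm_num) using 1
    module
  smul_mem' := by
    intro c w hw
    have h2 : Tendsto (fun t : ℝ => t * c) (𝓝 0) (𝓝 0) := by
      have : Continuous (fun t : ℝ => t * c) := by fun_prop
      simpa using this.tendsto 0
    filter_upwards [h2.eventually hw] with t hw
    rwa [smul_smul]

section faceDir

variable {X : Type*} [NormedAddCommGroup X] [NormedSpace ℝ X] {A : Set X}
  (hA : Convex ℝ A) {x y : X} (hx : x ∈ A)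

theorem mem_faceDir {w : X} : w ∈ faceDir hA hx ↔ ∀ᶠ t : ℝ in 𝓝 0, x + t • w ∈ A := Iff.rfl

theorem exists_pos_add_smul_mem {w : X} (hw : w ∈ faceDir hA hx) :
    ∃ t : ℝ, 0 < t ∧ t < 1 ∧ x + t • w ∈ A := by
  obtain ⟨t, ht, h0, h1⟩ := ((((mem_faceDir hA hx).1 hw).filter_mono
    (nhdsWithin_le_nhds (s := Ioi 0))).and (Ioo_mem_nhdsGT one_pos)).exists
  exact ⟨t, h0, h1, ht⟩

theorem mem_faceDir_of_mem_interior (hxA : x ∈ interior A) (w : X) : w ∈ faceDir hA hx := by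
  have h : Tendsto (fun t : ℝ => x + t • w) (𝓝 0) (𝓝 x) := by
    have : Continuous (fun t : ℝ => x + t • w) := by fun_prop
    simpa using this.tendsto 0
  exact (h.eventually (mem_interior_iff_mem_nhds.1 hxA) :)

/-- A segment inside `A` starting at `y` and passing through `x` in its interior carries the
directions available at `y` over to `x`. -/
theorem faceDir_le_of_mem_openSegment {z : X} (hy : y ∈ A) (hz : z ∈ A)
    (hxyz : x ∈ openSegment ℝ y z) :
    faceDir hA hy ≤ faceDir hA hx := by
  intro w hw
  obtain ⟨a, b, ha, hb, hab, rfl⟩ := hxyz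
  have h2 : Tendsto (fun t : ℝ => a⁻¹ * t) (𝓝 0) (𝓝 0) := by
    have : Continuous (fun t : ℝ => a⁻¹ * t) := by fun_prop
    simpa using this.tendsto 0
  rw [mem_faceDir]
  filter_upwards [h2.eventually hw] with t ht
  convert hA ht hz ha.le hb.le hab using 1
  rw [smul_add, smul_smul, mul_inv_cancel_left₀ ha.ne']
  abel

theorem sub_mem_faceDir_of_mem_openSegment {z : X} (hy : y ∈ A) (hz : z ∈ A)
    (hxyz : x ∈ openSegment ℝ y z) :
    y - x ∈ faceDir hA hx := by
  obtain ⟨a, b, ha, hb, hab, rfl⟩ := hxyz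
  have hyz : y - z ∈ faceDir hA hx := by
    rw [mem_faceDir]
    filter_upwards [Ioo_mem_nhds (neg_neg_of_pos ha) hb] with t ht
    convert hA hy hz (a := a + t) (b := b - t) (by linarith [ht.1]) (by linarith [ht.2])
      (by linarith) using 1
    module
  convert Submodule.smul_mem _ b hyz using 1
  obtain rfl : a = 1 - b := by linarith
  module

/-- One can move a little inside `A` from `x` along a direction that points to an element of `A`
up to a direction available at `x`. -/
theorem exists_add_smul_mem_of_mem_faceDir (hy : y ∈ A) {w : X} (hw : w ∈ faceDir hA hx) :
    ∃ t : ℝ, 0 < t ∧ x + t • (y - x - w) ∈ A := by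
  obtain ⟨t, h0, h1, ht⟩ := exists_pos_add_smul_mem hA hx (neg_mem hw)
  refine ⟨t / 2, by linarith, ?_⟩
  convert hA ht (hA hx hy (sub_nonneg.2 h1.le) h0.le (by ring)) (a := 1 / 2) (b := 1 / 2)
    (by norm_num) (by norm_num) (by norm_num) using 1
  module

end faceDir

section SelfMap

variable {X : Type*} [NormedAddCommGroup X] [NormedSpace ℝ X] {h : X → X}

/-- If an isometric self-map `h` of the unit sphere satisfies `‖x + h x‖ = 2`, then `h` preserves
the exposed faces of the unit ball. -/
theorem map_apply_eq_of_forall_le (hS : ∀ x ∈ sphere (0 : X) 1, h x ∈ sphere (0 : X) 1)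
    (hiso : ∀ x ∈ sphere (0 : X) 1, ∀ y ∈ sphere (0 : X) 1, ‖h x - h y‖ = ‖x - y‖)
    (hadd : ∀ x ∈ sphere (0 : X) 1, ‖x + h x‖ = 2) {g : X →ₗ[ℝ] ℝ} {x : X}
    (hx : x ∈ sphere (0 : X) 1) (hg : ∀ y ∈ closedBall (0 : X) 1, g y ≤ g x) :
    g (h x) = g x := by
  set u := h x with hu
  have hxn : ‖x‖ = 1 := by simpa using hx
  have hun : ‖u‖ = 1 := by simpa using hS x hx
  refine le_antisymm (hg u (by simp [hun])) (le_of_not_gt fun hlt => ?_)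
  have hneg : -g u ≤ g x := by simpa using hg (-u) (by simp [hun])
  have hpos : 0 < g x := by linarith
  have hgle : ∀ y, g y ≤ g x * ‖y‖ := by
    intro y
    rcases eq_or_ne y 0 with rfl | hy
    · simp
    · have := hg (‖y‖⁻¹ • y) (by simp [norm_smul, hy])
      rwa [map_smul, smul_eq_mul, inv_mul_le_iff₀ (by positivity), mul_comm] at this
  obtain ⟨q, hq⟩ : ∃ q, g u = q * g x := ⟨g u / g x, by field_simp⟩
  have hq1 : q < 1 := by nlinarith
  have hq2 : -1 ≤ q := by nlinarith
  obtain ⟨t, ht⟩ : ∃ t, t = (1 - q) / 4 := ⟨_, rfl⟩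
  have ht0 : 0 < t := by linarith
  set y := x - t • u with hy
  have htu : ‖t • u‖ = t := by rw [norm_smul, hun, mul_one, Real.norm_of_nonneg ht0.le]
  have hy1 : 1 - t * q ≤ ‖y‖ := by
    have := hgle y
    rw [hy, map_sub, map_smul, smul_eq_mul, hq] at this
    nlinarith
  have hy2 : |1 - ‖y‖| ≤ t := by
    have := abs_norm_sub_norm_le x y
    rwa [hxn, hy, sub_sub_cancel, htu] at this
  have hy0 : 0 < ‖y‖ := by linarith [le_abs_self (1 - ‖y‖)]
  set z := ‖y‖⁻¹ • y with hz
  have hyz : y = ‖y‖ • z := by rw [hz, smul_inv_smul₀ hy0.ne']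
  have hzn : ‖z‖ = 1 := by simp [hz, norm_smul, hy0.ne']
  have hzS : z ∈ sphere (0 : X) 1 := by simpa using hzn
  have hhz : ‖h z‖ = 1 := by simpa using hS z hzS
  have hzx : ‖z - x‖ ≤ 2 * t := by
    have h1 : z - x = (1 - ‖y‖) • z - t • u := by
      rw [sub_smul, ← hyz, one_smul, hy]
      abel
    calc ‖z - x‖ ≤ ‖(1 - ‖y‖) • z‖ + ‖t • u‖ := h1 ▸ norm_sub_le _ _
      _ ≤ 2 * t := by rw [norm_smul, hzn, htu, Real.norm_eq_abs]; linarith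
  obtain ⟨G, hG, hGz⟩ := exists_dual_vector'' ℝ (z + h z)
  have hGle : ∀ v, G v ≤ ‖v‖ := fun v =>
    (le_abs_self _).trans ((G.le_opNorm v).trans (mul_le_of_le_one_left (norm_nonneg v) hG))
  rw [hadd z hzS, map_add] at hGz
  simp only [RCLike.ofReal_real_eq_id, id_eq] at hGz
  have hG1 : G z = 1 := by linarith [hGle z, hGle (h z)]
  have hG2 : G (h z) = 1 := by linarith
  have hGy : G x - t * G u = ‖y‖ := by
    have : G y = ‖y‖ := by rw [hyz, map_smul, hG1]; simp [hzn, norm_smul]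
    rwa [hy, map_sub, map_smul, smul_eq_mul, ← hy] at this
  have hGu : G u ≤ q := by
    have := hGle x
    nlinarith
  have hGu' := hGle (h z - u)
  rw [map_sub, hu, hiso z hzS x hx, ← hu] at hGu'
  linarith

/-- If `h` moves `x` along a direction of the face of `x`, and fixes all points with smaller
faces, then it fixes `x`. -/
theorem eq_self_of_sub_mem_faceDir [FiniteDimensional ℝ X]
    (hiso : ∀ x ∈ sphere (0 : X) 1, ∀ y ∈ sphere (0 : X) 1, ‖h x - h y‖ = ‖x - y‖)
    {x : X} (hx : x ∈ sphere (0 : X) 1)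
    (hfix : ∀ y (hy : y ∈ sphere (0 : X) 1),
      faceDir (convex_closedBall (0 : X) 1) (sphere_subset_closedBall hy) <
        faceDir (convex_closedBall (0 : X) 1) (sphere_subset_closedBall hx) → h y = y)
    (hmem : h x - x ∈ faceDir (convex_closedBall (0 : X) 1) (sphere_subset_closedBall hx)) :
    h x = x := by
  by_contra hne
  set B := closedBall (0 : X) 1
  have hB : Convex ℝ B := convex_closedBall 0 1
  have hxB : x ∈ B := sphere_subset_closedBall hx
  set v := x - h x with hv
  have hv0 : 0 < ‖v‖ := norm_pos_iff.2 (sub_ne_zero.2 (Ne.symm hne))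
  have hvmem : v ∈ faceDir hB hxB := by simpa [hv] using neg_mem hmem
  have hcomp : IsCompact {t : ℝ | 0 ≤ t ∧ x + t • v ∈ B} := by
    refine (isCompact_Icc (a := 0) (b := 2 / ‖v‖)).of_isClosed_subset ?_ fun t ht => ⟨ht.1, ?_⟩
    · exact isClosed_Ici.inter (isClosed_closedBall.preimage (by fun_prop))
    · rw [le_div_iff₀ hv0]
      have h1 : ‖x + t • v‖ ≤ 1 := by simpa [B] using ht.2
      have h2 : ‖x‖ = 1 := by simpa using hx
      have h3 : ‖t • v‖ ≤ ‖x + t • v‖ + ‖x‖ := by simpa using norm_sub_le (x + t • v) x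
      rw [norm_smul, Real.norm_of_nonneg ht.1] at h3
      linarith
  obtain ⟨t, ⟨ht0, htB⟩, htmax⟩ := hcomp.exists_isGreatest ⟨0, le_rfl, by simpa using hxB⟩
  set p := x + t • v with hp
  have hvp : v ∉ faceDir hB htB := by
    intro hcon
    obtain ⟨s, hs0, -, hs⟩ := exists_pos_add_smul_mem hB htB hcon
    have : t + s ≤ t := htmax ⟨add_nonneg ht0 hs0.le, by rwa [add_smul, ← add_assoc]⟩
    linarith
  have hpS : p ∈ sphere (0 : X) 1 := by
    rw [mem_sphere_zero_iff_norm]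
    refine le_antisymm (by simpa [B] using htB) (le_of_not_gt fun hlt => hvp ?_)
    exact mem_faceDir_of_mem_interior hB htB (ball_subset_interior_closedBall (by simpa)) v
  have hle : faceDir hB htB ≤ faceDir hB hxB := by
    obtain ⟨s, hs0, -, hs⟩ := exists_pos_add_smul_mem hB hxB (neg_mem hvmem)
    rcases ht0.eq_or_lt with rfl | ht0
    · simp [hp]
    · refine faceDir_le_of_mem_openSegment hB hxB htB hs
        ⟨s / (s + t), t / (s + t), by positivity, by positivity, by field_simp, ?_⟩
      rw [hp]
      match_scalars <;> field_simp <;> ring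
  have hhp : h p = p := hfix p hpS (lt_of_le_not_ge hle fun hcon => hvp (hcon hvmem))
  have key := hiso p hpS x hx
  have h1 : p - h x = (1 + t) • v := by rw [hp, add_smul, one_smul, hv]; abel
  rw [hhp, h1, hp, add_sub_cancel_left, norm_smul, norm_smul, Real.norm_of_nonneg ht0,
    Real.norm_of_nonneg (by linarith)] at key
  linarith

/-- Every point of the unit sphere is a limit of points whose faces are either of smaller dimension,
or of the same dimension and exposed. -/
theorem exists_near_finrank_faceDir_lt_or_exposed [FiniteDimensional ℝ X] {x : X}
    (hx : x ∈ sphere (0 : X) 1) {U : Set X} (hU : IsOpen U) (hxU : x ∈ U) :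
    ∃ (y : X) (hy : y ∈ sphere (0 : X) 1), y ∈ U ∧
      (Module.finrank ℝ (faceDir (convex_closedBall (0 : X) 1) (sphere_subset_closedBall hy)) <
        Module.finrank ℝ (faceDir (convex_closedBall (0 : X) 1) (sphere_subset_closedBall hx)) ∨
      Module.finrank ℝ (faceDir (convex_closedBall (0 : X) 1) (sphere_subset_closedBall hy)) =
        Module.finrank ℝ (faceDir (convex_closedBall (0 : X) 1) (sphere_subset_closedBall hx)) ∧
      ∃ g : X →ₗ[ℝ] ℝ, ∀ z ∈ closedBall (0 : X) 1, g z ≤ g y ∧ (g z = g y →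
        z - y ∈ faceDir (convex_closedBall (0 : X) 1) (sphere_subset_closedBall hy))) := by
  set B := closedBall (0 : X) 1
  have hB : Convex ℝ B := convex_closedBall 0 1
  have hxB : x ∈ B := sphere_subset_closedBall hx
  obtain ⟨N, hN⟩ := (faceDir hB hxB).exists_isCompl
  set K : Set X := {y | y ∈ B ∧ y - x ∈ N} with hKdef
  have hK : IsCompact K := by
    refine (isCompact_closedBall (0 : X) 1).inter_right (t := {y | y - x ∈ N}) ?_
    exact N.closed_of_finiteDimensional.preimage (by fun_prop)
  have hKconv : Convex ℝ K := by
    rintro y ⟨hy, hyN⟩ z ⟨hz, hzN⟩ a b ha hb hab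
    refine ⟨hB hy hz ha hb hab, ?_⟩
    convert N.add_mem (N.smul_mem a hyN) (N.smul_mem b hzN) using 1
    obtain rfl : a = 1 - b := by linarith
    module
  have hext : x ∈ K.extremePoints ℝ := by
    refine mem_extremePoints.2 ⟨⟨hxB, by simp⟩, ?_⟩
    have key : ∀ y ∈ K, ∀ z ∈ K, x ∈ openSegment ℝ y z → y = x := fun y hy z hz hxyz =>
      sub_eq_zero.1 <| Submodule.disjoint_def.1 hN.disjoint _
        (sub_mem_faceDir_of_mem_openSegment hB hxB hy.1 hz.1 hxyz) hy.2
    exact fun y hy z hz hxyz => ⟨key y hy z hz hxyz, key z hz y hy (openSegment_symm ℝ y z ▸ hxyz)⟩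
  obtain ⟨y, ⟨⟨hyB, hyN⟩, hyU⟩, l, hl⟩ := exists_exposed_near_extremePoint hK hKconv hext hU hxU
  have hmemK : ∀ w ∈ N, ∀ t : ℝ, y + t • w ∈ B → y + t • w ∈ K := fun w hw t ht => ⟨ht, by
    convert N.add_mem hyN (N.smul_mem t hw) using 1
    abel⟩
  have hpos : ∀ w ∈ N, ∀ t : ℝ, 0 < t → y + t • w ∈ B → l w ≤ 0 ∧ (l w = 0 → w = 0) := by
    intro w hw t ht hwB
    by_cases hw0 : w = 0
    · simp [hw0]
    · have := hl _ (hmemK w hw t hwB) (by simp [ht.ne', hw0])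
      have : l w < 0 := by
        simp only [map_add, map_smul, smul_eq_mul] at this
        nlinarith
      exact ⟨this.le, fun h0 => absurd h0 this.ne⟩
  have hdisj : Disjoint N (faceDir hB hyB) := by
    refine Submodule.disjoint_def.2 fun w hwN hw => ?_
    have key : ∀ w ∈ N, w ∈ faceDir hB hyB → l w ≤ 0 ∧ (l w = 0 → w = 0) := by
      intro w hwN hw
      obtain ⟨s, hs0, -, hs⟩ := exists_pos_add_smul_mem hB hyB hw
      exact hpos w hwN s hs0 hs
    have h1 := key w hwN hw
    have h2 := (key (-w) (neg_mem hwN) (neg_mem hw)).1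
    rw [map_neg] at h2
    exact h1.2 (by linarith [h1.1])
  have hyS : y ∈ sphere (0 : X) 1 := by
    rw [mem_sphere_zero_iff_norm]
    refine le_antisymm (by simpa [B] using hyB) (le_of_not_gt fun hlt => ?_)
    have hcont := mem_faceDir_of_mem_interior hB hyB
      (ball_subset_interior_closedBall (by simpa))
    have hNbot : N = ⊥ := by
      rw [eq_bot_iff]
      exact fun w hw => Submodule.disjoint_def.1 hdisj w hw (hcont w)
    have htop : x ∈ faceDir hB hxB := by
      have := hN.codisjoint.eq_top
      rw [hNbot, sup_bot_eq] at this
      simp [this]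
    obtain ⟨s, hs0, -, hs⟩ := exists_pos_add_smul_mem hB hxB htop
    have hxn : ‖x‖ = 1 := by simpa using hx
    have : ‖(1 + s) • x‖ ≤ 1 := by simpa [B, add_smul] using hs
    rw [norm_smul, hxn, Real.norm_of_nonneg (by linarith)] at this
    linarith
  refine ⟨y, hyS, hyU, ?_⟩
  have hdim := Submodule.finrank_add_eq_of_isCompl hN
  have hdim' := Submodule.finrank_add_finrank_le_of_disjoint hdisj
  refine (lt_or_eq_of_le (by omega :
    Module.finrank ℝ (faceDir hB hyB) ≤ Module.finrank ℝ (faceDir hB hxB))).imp_right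
      fun heq => ⟨heq, ?_⟩
  have hcompl : IsCompl N (faceDir hB hyB) :=
    (Submodule.isCompl_iff_disjoint _ _ (by omega)).2 hdisj
  refine ⟨l ∘ₗ N.projection _ hcompl, fun z hz => ?_⟩
  obtain ⟨a, b, hab⟩ : ∃ a : N, ∃ b : faceDir hB hyB, (a : X) + b = z - y := by
    have : z - y ∈ N ⊔ faceDir hB hyB := by simp [hcompl.codisjoint.eq_top]
    obtain ⟨a, ha, b, hb, hab⟩ := Submodule.mem_sup.1 this
    exact ⟨⟨a, ha⟩, ⟨b, hb⟩, hab⟩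
  obtain ⟨t, ht0, ht⟩ := exists_add_smul_mem_of_mem_faceDir hB hyB hz b.2
  rw [← hab, add_sub_cancel_right] at ht
  have hla := hpos a a.2 t ht0 ht
  have hg : (l ∘ₗ N.projection _ hcompl) z = (l ∘ₗ N.projection _ hcompl) y + l a := by
    rw [← sub_eq_iff_eq_add', ← map_sub, ← hab]
    simp
  refine ⟨by linarith [hla.1], fun h0 => ?_⟩
  rw [← hab, hla.2 (by linarith), zero_add]
  exact b.2

/-- The identity is the only isometric self-map `h` of the unit sphere of a finite-dimensional
space with `‖x + h x‖ = 2` for all `x`. -/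
theorem eq_self_of_norm_add_eq_two [FiniteDimensional ℝ X]
    (hS : ∀ x ∈ sphere (0 : X) 1, h x ∈ sphere (0 : X) 1)
    (hiso : ∀ x ∈ sphere (0 : X) 1, ∀ y ∈ sphere (0 : X) 1, ‖h x - h y‖ = ‖x - y‖)
    (hadd : ∀ x ∈ sphere (0 : X) 1, ‖x + h x‖ = 2) {x : X} (hx : x ∈ sphere (0 : X) 1) :
    h x = x := by
  induction hk : Module.finrank ℝ
    (faceDir (convex_closedBall (0 : X) 1) (sphere_subset_closedBall hx))
    using Nat.strong_induction_on generalizing x with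
  | h k ih =>
    have hnear : ∀ ε > 0, ∃ y ∈ sphere (0 : X) 1, ‖x - y‖ < ε ∧ h y = y := by
      intro ε hε
      obtain ⟨y, hy, hyU, hor⟩ := exists_near_finrank_faceDir_lt_or_exposed hx
        (isOpen_ball (x := x) (ε := ε)) (mem_ball_self hε)
      refine ⟨y, hy, by rwa [norm_sub_rev, ← mem_ball_iff_norm], ?_⟩
      rcases hor with hlt | ⟨heq, g, hg⟩
      · exact ih _ (hk ▸ hlt) hy rfl
      · refine eq_self_of_sub_mem_faceDir hiso hy (fun z hz hlt => ih _ ?_ hz rfl) ?_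
        · rw [← hk, ← heq]
          exact Submodule.finrank_lt_finrank_of_lt hlt
        · exact (hg _ (sphere_subset_closedBall (hS y hy))).2
            (map_apply_eq_of_forall_le hS hiso hadd hy fun z hz => (hg z hz).1)
    rw [← sub_eq_zero, ← norm_le_zero_iff]
    refine le_of_forall_pos_le_add fun ε hε => ?_
    obtain ⟨y, hy, hxy, hfix⟩ := hnear (ε / 2) (by positivity)
    calc ‖h x - x‖ = ‖(h x - h y) - (x - y)‖ := by rw [hfix]; congr 1; abel
      _ ≤ ‖h x - h y‖ + ‖x - y‖ := norm_sub_le _ _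
      _ ≤ 0 + ε := by rw [hiso x hx y hy]; linarith

end SelfMap

/-- **Tingley's theorem.** An onto isometry between the unit spheres of finite-dimensional
real normed spaces is odd: `f (-x) = - f x` for every `x` on the sphere. -/
theorem tingley {X E : Type*} [NormedAddCommGroup X] [NormedSpace ℝ X] [FiniteDimensional ℝ X]
    [NormedAddCommGroup E] [NormedSpace ℝ E] [FiniteDimensional ℝ E]
    (f : X → E) (hbij : Set.BijOn f (sphere (0 : X) 1) (sphere (0 : E) 1))
    (hiso : ∀ x ∈ sphere (0 : X) 1, ∀ x' ∈ sphere (0 : X) 1, ‖f x - f x'‖ = ‖x - x'‖) :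
    ∀ x ∈ sphere (0 : X) 1, f (-x) = -f x := by
  have hnegS : ∀ x ∈ sphere (0 : X) 1, -x ∈ sphere (0 : X) 1 := fun x hx => by simpa using hx
  have hex : ∀ x, ∃ y, x ∈ sphere (0 : X) 1 → y ∈ sphere (0 : X) 1 ∧ f y = -f (-x) := by
    intro x
    by_cases hx : x ∈ sphere (0 : X) 1
    · obtain ⟨y, hy, hyx⟩ := hbij.surjOn (show -f (-x) ∈ sphere (0 : E) 1 by
        simpa using hbij.mapsTo (hnegS x hx))
      exact ⟨y, fun _ => ⟨hy, hyx⟩⟩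
    · exact ⟨0, fun h => absurd h hx⟩
  choose h hh using hex
  intro x hx
  have hfix : h x = x := by
    refine eq_self_of_norm_add_eq_two (fun x hx => (hh x hx).1) (fun x hx y hy => ?_)
      (fun x hx => ?_) hx
    · rw [← hiso _ (hh x hx).1 _ (hh y hy).1, (hh x hx).2, (hh y hy).2, neg_sub_neg,
        hiso _ (hnegS y hy) _ (hnegS x hx), neg_sub_neg]
    · have hn : ‖f (-x)‖ = 1 := by simpa using hbij.mapsTo (hnegS x hx)
      have := hiso _ (hh x hx).1 _ (hnegS x hx)
      rw [(hh x hx).2, sub_neg_eq_add, ← neg_add', norm_neg, ← two_smul ℝ, norm_smul, hn] at this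
      rw [add_comm, ← this]
      norm_num
  have := (hh x hx).2
  rw [hfix] at this
  rw [this, neg_neg]
end
end

section
/- Let X be a finite-dimensional real normed space and let x, y ∈ S_X with x ≠ y be such that (x − y)/‖x − y‖ is a smooth point of S_X with unique support functional γ((x − y)/‖x − y‖). Let (y_n) be a sequence in S_X \ {y} with y_n → y and (y − y_n)/‖y − y_n‖ → u. Then (‖x − y_n‖ − ‖x − y‖)/‖y − y_n‖ → ⟨γ((x − y)/‖x − y‖), u⟩ as n → ∞. -/
open Filter Topology Metric Set MeasureTheory

noncomputable section

/-- A functional of norm at most one that attains `‖v‖` at `v ≠ 0` supports the unit ball at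
the direction of `v`. -/
theorem mem_suppFn_unitDir {X : Type*} [NormedAddCommGroup X] [NormedSpace ℝ X] {v : X}
    (hv : v ≠ 0) {f : X →L[ℝ] ℝ} (hf : ‖f‖ ≤ 1) (hfv : f v = ‖v‖) :
    f ∈ suppFn X (unitDir v) := by
  have hpos : 0 < ‖v‖ := norm_pos_iff.mpr hv
  refine ⟨le_antisymm hf ?_, ?_⟩
  · have h := f.le_opNorm v
    rw [hfv, norm_norm] at h
    exact le_of_mul_le_mul_right (by simpa using h) hpos
  · rw [unitDir, map_smul, hfv, smul_eq_mul, inv_mul_cancel₀ hpos.ne']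

/-- The value at `v` of a support functional at the direction of `v ≠ 0` is `‖v‖`. -/
theorem apply_eq_norm_of_mem_suppFn {X : Type*} [NormedAddCommGroup X] [NormedSpace ℝ X] {v : X}
    (hv : v ≠ 0) {f : X →L[ℝ] ℝ} (hf : f ∈ suppFn X (unitDir v)) : f v = ‖v‖ := by
  have hpos : 0 < ‖v‖ := norm_pos_iff.mpr hv
  have h := hf.2
  rw [unitDir, map_smul, smul_eq_mul] at h
  field_simp at h
  exact h

/-- At a smooth point, norming functionals of vectors converging to `v` converge to the support
functional of `v`. -/
theorem tendsto_norming_functional {X : Type*} [NormedAddCommGroup X] [NormedSpace ℝ X]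
    [FiniteDimensional ℝ X] {v : X} (hv : v ≠ 0) {g : X →L[ℝ] ℝ}
    (hg : suppFn X (unitDir v) = {g}) {w : ℕ → X} (hw : Tendsto w atTop (𝓝 v))
    {f : ℕ → X →L[ℝ] ℝ} (hf : ∀ n, ‖f n‖ ≤ 1) (hfw : ∀ n, f n (w n) = ‖w n‖) :
    Tendsto f atTop (𝓝 g) := by
  have hlim : Tendsto (fun n => f n v) atTop (𝓝 ‖v‖) := by
    have hdiff : Tendsto (fun n => f n (w n - v)) atTop (𝓝 0) :=
      squeeze_zero_norm (fun n => (f n).le_of_opNorm_le (hf n) _)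
        (by simpa using (hw.sub_const v).norm)
    simpa [hfw] using hw.norm.sub hdiff
  have : ProperSpace (X →L[ℝ] ℝ) := FiniteDimensional.proper ℝ _
  refine (isCompact_closedBall (0 : X →L[ℝ] ℝ) 1).tendsto_nhds_of_unique_mapClusterPt
    (Eventually.of_forall fun n => by simpa using hf n) fun φ hφ hcl => ?_
  have hev : MapClusterPt (φ v) atTop (fun n => f n v) :=
    hcl.continuousAt_comp (ContinuousLinearMap.apply ℝ ℝ v).continuous.continuousAt
  have hmem := mem_suppFn_unitDir hv (by simpa using hφ)
    (eq_of_nhds_neBot (hev.clusterPt.mono hlim))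
  rwa [hg] at hmem

/-- **Lemma 1.** If `(x - y)/‖x - y‖` is a smooth point with support functional `g`, and
`y_n → y` on the sphere with `(y - y_n)/‖y - y_n‖ → u`, then
`(‖x - y_n‖ - ‖x - y‖)/‖y - y_n‖ → ⟨g, u⟩`. -/
theorem lemma1 {X : Type*} [NormedAddCommGroup X] [NormedSpace ℝ X] [FiniteDimensional ℝ X]
    (x y : X) (hx : x ∈ sphere (0 : X) 1) (hy : y ∈ sphere (0 : X) 1) (hxy : x ≠ y)
    (g : X →L[ℝ] ℝ) (hg : suppFn X (unitDir (x - y)) = {g})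
    (yn : ℕ → X) (hyn : ∀ n, yn n ∈ sphere (0 : X) 1 ∧ yn n ≠ y)
    (hconv : Tendsto yn atTop (𝓝 y))
    (u : X) (hu : Tendsto (fun n => unitDir (y - yn n)) atTop (𝓝 u)) :
    Tendsto (fun n => (‖x - yn n‖ - ‖x - y‖) / ‖y - yn n‖) atTop (𝓝 (g u)) := by
  have hv : x - y ≠ 0 := sub_ne_zero.mpr hxy
  have hw : Tendsto (fun n => x - yn n) atTop (𝓝 (x - y)) := hconv.const_sub x
  have hgmem : g ∈ suppFn X (unitDir (x - y)) := hg ▸ mem_singleton g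
  choose f hf hfw using fun n => exists_dual_vector'' ℝ (x - yn n)
  have hfg : Tendsto f atTop (𝓝 g) := tendsto_norming_functional hv hg hw hf hfw
  have hpos (n : ℕ) : 0 < ‖y - yn n‖ := norm_pos_iff.mpr (sub_ne_zero.mpr (hyn n).2.symm)
  have hquot (φ : X →L[ℝ] ℝ) (n : ℕ) :
      φ (unitDir (y - yn n)) = (φ (x - yn n) - φ (x - y)) / ‖y - yn n‖ := by
    rw [← map_sub, sub_sub_sub_cancel_left, unitDir, map_smul, smul_eq_mul, inv_mul_eq_div]
  have hle {φ : X →L[ℝ] ℝ} (hφ : ‖φ‖ ≤ 1) (z : X) : φ z ≤ ‖z‖ :=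
    (le_abs_self _).trans ((φ.le_of_opNorm_le hφ z).trans_eq (one_mul _))
  refine tendsto_of_tendsto_of_tendsto_of_le_of_le ((g.continuous.tendsto u).comp hu)
    ((isBoundedBilinearMap_apply.continuous.tendsto (g, u)).comp (hfg.prodMk_nhds hu)) (fun n => ?_) fun n => ?_
  · simp only [Function.comp_apply, hquot, apply_eq_norm_of_mem_suppFn hv hgmem]
    exact div_le_div_of_nonneg_right (sub_le_sub_right (hle hgmem.1.le _) _) (hpos n).le
  · simp only [Function.comp_apply, hquot]
    rw [show f n (x - yn n) = ‖x - yn n‖ from hfw n]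
    exact div_le_div_of_nonneg_right (sub_le_sub_left (hle (hf n) _) _) (hpos n).le
end
end

section
/- Let X and E be finite-dimensional real normed spaces of the same dimension m and f : S_X → S_E a bijective isometry. For every y ∈ S_X, the set D_y \ W_y is negligible in D_y (it has zero (m−1)-dimensional Hausdorff measure); in particular, W_y is dense in D_y. -/
open Filter Topology Metric Set MeasureTheory

noncomputable section

/-- A set mapped into a Hausdorff-null set by a map with Lipschitz inverse is Hausdorff-null. -/
theorem hausdorffMeasure_eq_zero_of_dist_le_mul {α β : Type*} [MetricSpace α] [MetricSpace β]
    [MeasurableSpace α] [BorelSpace α] [MeasurableSpace β] [BorelSpace β]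
    {d K : ℝ} (hd : 0 ≤ d) (hK : 0 ≤ K) {s : Set α} {t : Set β} {F : α → β}
    (hF : ∀ x ∈ s, ∀ x' ∈ s, dist x x' ≤ K * dist (F x) (F x'))
    (hst : MapsTo F s t) (ht : μH[d] t = 0) : μH[d] s = 0 := by
  rcases s.eq_empty_or_nonempty with rfl | ⟨a, _⟩
  · simp
  have : Nonempty α := ⟨a⟩
  have hinj : InjOn F s := fun x hx x' hx' h => by
    have := hF x hx x' hx'
    rw [h, dist_self, mul_zero] at this
    exact dist_le_zero.1 this
  have hleft := hinj.leftInvOn_invFunOn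
  have hlip : LipschitzOnWith ⟨K, hK⟩ (Function.invFunOn F s) (F '' s) := by
    refine LipschitzOnWith.of_dist_le_mul ?_
    rintro _ ⟨x, hx, rfl⟩ _ ⟨x', hx', rfl⟩
    rw [hleft hx, hleft hx']
    exact hF x hx x' hx'
  have h := hlip.hausdorffMeasure_image_le hd
  rw [hleft.image_image, measure_mono_null hst.image_subset ht, mul_zero] at h
  exact nonpos_iff_eq_zero.1 h

/-- The projection onto the kernel of `φ` along a vector `v` with `φ v = 1`. -/
theorem exists_ker_projection {X : Type*} [NormedAddCommGroup X] [NormedSpace ℝ X]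
    (φ : X →L[ℝ] ℝ) {v : X} (hv : φ v = 1) :
    ∃ P : X →L[ℝ] LinearMap.ker (φ : X →ₗ[ℝ] ℝ), ∀ x, (P x : X) = x - φ x • v := by
  refine ⟨(ContinuousLinearMap.id ℝ X - φ.smulRight v).codRestrict _ fun x => ?_, fun x => ?_⟩
  · simp [hv]
  · simp

theorem finrank_ker_eq_sub_one {X : Type*} [NormedAddCommGroup X] [NormedSpace ℝ X]
    [FiniteDimensional ℝ X] (φ : X →L[ℝ] ℝ) {v : X} (hv : φ v = 1) :
    (Module.finrank ℝ (LinearMap.ker (φ : X →ₗ[ℝ] ℝ)) : ℝ) = (Module.finrank ℝ X : ℝ) - 1 := by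
  have hne : (φ : X →ₗ[ℝ] ℝ) ≠ 0 := fun h => by
    have : (φ : X →ₗ[ℝ] ℝ) v = 0 := by rw [h]; rfl
    simp [hv] at this
  have := Module.Dual.finrank_ker_add_one_of_ne_zero hne
  rw [← this]
  push_cast
  ring

theorem norm_unitDir {X : Type*} [NormedAddCommGroup X] [NormedSpace ℝ X] {v : X} (hv : v ≠ 0) :
    ‖unitDir v‖ = 1 := by
  simp [unitDir, norm_smul, hv]

theorem unitDir_smul {X : Type*} [NormedAddCommGroup X] [NormedSpace ℝ X] {a : ℝ} (ha : 0 < a)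
    (v : X) : unitDir (a • v) = unitDir v := by
  rw [unitDir, unitDir, norm_smul, Real.norm_of_nonneg ha.le, smul_smul, mul_inv]
  congr 1
  field_simp

theorem exists_mem_suppFn {X : Type*} [NormedAddCommGroup X] [NormedSpace ℝ X] {x : X}
    (hx : ‖x‖ = 1) : ∃ g, g ∈ suppFn X x := by
  obtain ⟨g, hg, hgx⟩ := exists_dual_vector ℝ x (by simp [hx])
  exact ⟨g, hg, by simpa [hx] using hgx⟩

theorem apply_le_norm_of_mem_suppFn {X : Type*} [NormedAddCommGroup X] [NormedSpace ℝ X] {x : X}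
    {g : X →L[ℝ] ℝ} (hg : g ∈ suppFn X x) (z : X) : g z ≤ ‖z‖ := by
  have := g.le_opNorm z
  rw [hg.1, one_mul] at this
  exact (le_abs_self _).trans this

/-- If the norm is differentiable along an affine hyperplane not through the origin, then its
radial projection there is a smooth point. -/
theorem isSmoothPt_of_differentiableAt {X : Type*} [NormedAddCommGroup X] [NormedSpace ℝ X]
    (φ : X →L[ℝ] ℝ) {v : X} (hv : φ v = 1) (h : LinearMap.ker (φ : X →ₗ[ℝ] ℝ))
    (hd : DifferentiableAt ℝ (fun k : LinearMap.ker (φ : X →ₗ[ℝ] ℝ) => ‖v + k‖) h) :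
    IsSmoothPt (unitDir (v + h)) := by
  have hφ : φ (v + h) = 1 := by
    have : φ (h : X) = 0 := h.2
    rw [map_add, hv, this, add_zero]
  have hne : v + (h : X) ≠ 0 := fun h0 => by simp [h0] at hφ
  obtain ⟨g, hg⟩ := exists_mem_suppFn (norm_unitDir hne)
  have val : ∀ k ∈ suppFn X (unitDir (v + (h : X))), k (v + h) = ‖v + (h : X)‖ := by
    intro k hk
    have h1 := hk.2
    have : ‖v + (h : X)‖ ≠ 0 := norm_ne_zero_iff.2 hne
    rw [unitDir, map_smul, smul_eq_mul] at h1
    field_simp at h1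
    exact h1
  have der : ∀ k ∈ suppFn X (unitDir (v + (h : X))),
      fderiv ℝ (fun k : LinearMap.ker (φ : X →ₗ[ℝ] ℝ) => ‖v + k‖) h
        = k.comp (LinearMap.ker (φ : X →ₗ[ℝ] ℝ)).subtypeL := by
    intro k hk
    rw [← sub_eq_zero]
    have hk' : HasFDerivAt (fun z : LinearMap.ker (φ : X →ₗ[ℝ] ℝ) => k v + k (z : X))
        (k.comp (LinearMap.ker (φ : X →ₗ[ℝ] ℝ)).subtypeL) h :=
      (k.comp (LinearMap.ker (φ : X →ₗ[ℝ] ℝ)).subtypeL).hasFDerivAt.const_add (k v)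
    refine IsLocalMin.hasFDerivAt_eq_zero ?_ (hd.hasFDerivAt.sub hk')
    refine Eventually.of_forall fun z => ?_
    have h1 := val k hk
    have h2 := apply_le_norm_of_mem_suppFn hk (v + z)
    rw [map_add] at h1 h2
    simp only [Pi.sub_apply]
    linarith
  refine ⟨g, Set.eq_singleton_iff_unique_mem.2 ⟨hg, fun k hk => ?_⟩⟩
  ext x
  obtain ⟨P, hP⟩ := exists_ker_projection φ hφ
  have hx : x = (P x : X) + φ x • (v + (h : X)) := by rw [hP]; abel
  have h1 : k (P x : X) = g (P x : X) :=
    DFunLike.congr_fun ((der k hk).symm.trans (der g hg)) (P x)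
  rw [hx, map_add, map_add, h1, map_smul, map_smul, val k hk, val g hg]

/-- The radial projections of almost all points of an affine hyperplane are smooth. -/
theorem hausdorffMeasure_not_isSmoothPt_ker {X : Type*} [NormedAddCommGroup X] [NormedSpace ℝ X]
    [FiniteDimensional ℝ X] [MeasurableSpace X] [BorelSpace X]
    (φ : X →L[ℝ] ℝ) {v : X} (hv : φ v = 1) :
    μH[(Module.finrank ℝ X : ℝ) - 1]
      {h : LinearMap.ker (φ : X →ₗ[ℝ] ℝ) | ¬ IsSmoothPt (unitDir (v + (h : X)))} = 0 := by
  rw [← finrank_ker_eq_sub_one φ hv]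
  have hl : LipschitzWith 1 (fun k : LinearMap.ker (φ : X →ₗ[ℝ] ℝ) => ‖v + k‖) := by
    refine LipschitzWith.of_dist_le_mul fun a b => ?_
    rw [Real.dist_eq, NNReal.coe_one, one_mul, dist_eq_norm]
    refine (abs_norm_sub_norm_le _ _).trans_eq ?_
    rw [add_sub_add_left_eq_sub]
    rfl
  have := hl.ae_differentiableAt
    (μ := μH[(Module.finrank ℝ (LinearMap.ker (φ : X →ₗ[ℝ] ℝ)) : ℝ)])
  exact measure_mono_null (fun h hh hd => hh (isSmoothPt_of_differentiableAt φ hv h hd)) this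

/-- The central projection from `y` onto a hyperplane has a Lipschitz inverse on the part of the
sphere that is seen from `y` uniformly through the interior of the ball. -/
theorem norm_sub_le_mul_norm_central_projection {X : Type*} [NormedAddCommGroup X]
    [NormedSpace ℝ X] {φ : X →L[ℝ] ℝ} (hφ : ‖φ‖ = 1) {y : X} (hy : ‖y‖ ≤ 1) {δ : ℝ} (hδ : 0 < δ)
    {x x' : X} (hx : ‖x‖ = 1) (hx' : ‖x'‖ = 1) (hxy : ‖x + y‖ ≤ 2 - δ) (hx'y : ‖x' + y‖ ≤ 2 - δ)
    (hpos : 0 < φ (x - y)) (hpos' : 0 < φ (x' - y)) :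
    ‖x - x'‖ ≤ (2 * (2 / δ) + 2) * ‖(φ (x - y))⁻¹ • (x - y) - (φ (x' - y))⁻¹ • (x' - y)‖ := by
  wlog hle : φ (x - y) ≤ φ (x' - y) generalizing x x'
  · rw [norm_sub_rev x, norm_sub_rev (_ • _)]
    exact this hx' hx hx'y hxy hpos' hpos (le_of_not_ge hle)
  set t := φ (x - y) with ht
  set t' := φ (x' - y) with ht'
  set z := t⁻¹ • (x - y) with hz
  set z' := t'⁻¹ • (x' - y) with hz'
  have hxz : x = y + t • z := by rw [hz, smul_inv_smul₀ hpos.ne']; abel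
  have hxz' : x' = y + t' • z' := by rw [hz', smul_inv_smul₀ hpos'.ne']; abel
  have htz : t * ‖z‖ ≤ 2 := by
    rw [← Real.norm_of_nonneg hpos.le, ← norm_smul, hz, smul_inv_smul₀ hpos.ne']
    linarith [norm_sub_le x y]
  have ht2 : t' ≤ 2 := by
    have := φ.le_opNorm (x' - y)
    rw [hφ, one_mul, Real.norm_eq_abs] at this
    linarith [norm_sub_le x' y, le_abs_self (φ (x' - y))]
  obtain ⟨ψ, hψ⟩ := exists_mem_suppFn hx
  have hψy : ψ y ≤ 1 - δ := by
    have := apply_le_norm_of_mem_suppFn hψ (x + y)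
    rw [map_add, hψ.2] at this
    linarith
  have hψz : t * ψ z = 1 - ψ y := by
    have := hψ.2
    rw [hxz, map_add, map_smul, smul_eq_mul] at this
    linarith
  have key : (t' - t) * ψ z ≤ t' * ‖z - z'‖ := by
    have h1 : y + t' • z = x' + t' • (z - z') := by rw [hxz', smul_sub]; abel
    have h2 : ψ (y + t' • z) = ψ y + t' * ψ z := by simp
    have h3 := apply_le_norm_of_mem_suppFn hψ (y + t' • z)
    have h4 : ‖y + t' • z‖ ≤ 1 + t' * ‖z - z'‖ := by
      rw [h1]
      refine (norm_add_le _ _).trans_eq ?_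
      rw [hx', norm_smul, Real.norm_of_nonneg hpos'.le]
    nlinarith
  have hn := norm_nonneg (z - z')
  have key2 : (t' - t) * δ ≤ t * (2 * ‖z - z'‖) := by
    calc (t' - t) * δ ≤ (t' - t) * (t * ψ z) := by
          apply mul_le_mul_of_nonneg_left <;> linarith
      _ = t * ((t' - t) * ψ z) := by ring
      _ ≤ t * (2 * ‖z - z'‖) := by
          apply mul_le_mul_of_nonneg_left _ hpos.le
          exact key.trans (mul_le_mul_of_nonneg_right ht2 hn)
  have key3 : (t' - t) * ‖z‖ ≤ 2 * (2 / δ) * ‖z - z'‖ := by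
    have : (t' - t) ≤ t * (2 * ‖z - z'‖) / δ := by rwa [le_div_iff₀ hδ]
    calc (t' - t) * ‖z‖ ≤ t * (2 * ‖z - z'‖) / δ * ‖z‖ :=
          mul_le_mul_of_nonneg_right this (norm_nonneg _)
      _ = (t * ‖z‖) * (2 / δ * ‖z - z'‖) := by ring
      _ ≤ 2 * (2 / δ * ‖z - z'‖) := mul_le_mul_of_nonneg_right htz (by positivity)
      _ = _ := by ring
  calc ‖x - x'‖ = ‖t' • (z - z') - (t' - t) • z‖ := by
        congr 1; rw [hxz, hxz', smul_sub, sub_smul]; abel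
    _ ≤ t' * ‖z - z'‖ + (t' - t) * ‖z‖ := by
        refine (norm_sub_le _ _).trans_eq ?_
        rw [norm_smul, norm_smul, Real.norm_of_nonneg hpos'.le,
          Real.norm_of_nonneg (sub_nonneg.2 hle)]
    _ ≤ 2 * ‖z - z'‖ + 2 * (2 / δ) * ‖z - z'‖ := by gcongr
    _ = _ := by ring

/-- Seen from a point `y` of the unit ball, almost all directions towards `D_y` are smooth. -/
theorem hausdorffMeasure_not_isSmoothPt_unitDir_sub {X : Type*} [NormedAddCommGroup X]
    [NormedSpace ℝ X] [FiniteDimensional ℝ X] [MeasurableSpace X] [BorelSpace X]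
    {y : X} (hy : ‖y‖ ≤ 1) :
    μH[(Module.finrank ℝ X : ℝ) - 1] {x ∈ Dset y | ¬ IsSmoothPt (unitDir (x - y))} = 0 := by
  refine measure_null_of_locally_null _ fun x₀ hx₀ => ?_
  have hne : x₀ - y ≠ 0 := fun h => by
    have h2 := hx₀.1.2
    rw [← sub_eq_zero.1 h, ← two_smul ℝ, norm_smul, mem_sphere_zero_iff_norm.1 hx₀.1.1] at h2
    norm_num at h2
  obtain ⟨φ, hφ, hφx⟩ := exists_dual_vector ℝ (x₀ - y) (norm_ne_zero_iff.2 hne)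
  have hφpos : 0 < φ (x₀ - y) := by rw [hφx]; exact norm_pos_iff.2 hne
  obtain ⟨v, hv⟩ : ∃ v, φ v = 1 :=
    ⟨(φ (x₀ - y))⁻¹ • (x₀ - y), by rw [map_smul, smul_eq_mul, inv_mul_cancel₀ hφpos.ne']⟩
  obtain ⟨P, hP⟩ := exists_ker_projection φ hv
  obtain ⟨δ, hδ, hδx⟩ : ∃ δ > 0, ‖x₀ + y‖ < 2 - δ :=
    ⟨(2 - ‖x₀ + y‖) / 2, by linarith [hx₀.1.2], by linarith [hx₀.1.2]⟩
  have hd : 0 ≤ (Module.finrank ℝ X : ℝ) - 1 := by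
    rw [← finrank_ker_eq_sub_one φ hv]; positivity
  have hU : {x | ‖x + y‖ < 2 - δ ∧ 0 < φ (x - y)} ∈ 𝓝 x₀ := by
    have h1 : IsOpen {x | ‖x + y‖ < 2 - δ} := isOpen_lt (by fun_prop) (by fun_prop)
    have h2 : IsOpen {x | 0 < φ (x - y)} := isOpen_lt (by fun_prop) (by fun_prop)
    exact (h1.inter h2).mem_nhds ⟨hδx, hφpos⟩
  refine ⟨_, inter_mem_nhdsWithin _ hU, ?_⟩
  have hchart : ∀ x, 0 < φ (x - y) →
      v + ((φ (x - y))⁻¹ • P (x - y) : LinearMap.ker (φ : X →ₗ[ℝ] ℝ))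
        = (φ (x - y))⁻¹ • (x - y) := by
    intro x hx
    rw [Submodule.coe_smul, hP, smul_sub, inv_smul_smul₀ hx.ne']
    abel
  refine hausdorffMeasure_eq_zero_of_dist_le_mul hd (K := 2 * (2 / δ) + 2) (by positivity)
    (F := fun x => (φ (x - y))⁻¹ • P (x - y)) ?_ ?_ (hausdorffMeasure_not_isSmoothPt_ker φ hv)
  · rintro x ⟨⟨⟨hx, _⟩, _⟩, hxy, hpos⟩ x' ⟨⟨⟨hx', _⟩, _⟩, hx'y, hpos'⟩
    have := norm_sub_le_mul_norm_central_projection hφ hy hδ (mem_sphere_zero_iff_norm.1 hx)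
      (mem_sphere_zero_iff_norm.1 hx') hxy.le hx'y.le hpos hpos'
    rw [← hchart x hpos, ← hchart x' hpos', add_sub_add_left_eq_sub] at this
    rw [dist_eq_norm, dist_eq_norm]
    exact this
  · rintro x ⟨⟨_, hns⟩, _, hpos⟩
    change ¬ IsSmoothPt _
    rwa [hchart x hpos, unitDir_smul (inv_pos.2 hpos)]

/-- Neighbourhoods in the unit sphere have positive `(m - 1)`-dimensional Hausdorff measure. -/
theorem hausdorffMeasure_sphere_inter_ne_zero {X : Type*} [NormedAddCommGroup X]
    [NormedSpace ℝ X] [FiniteDimensional ℝ X] [MeasurableSpace X] [BorelSpace X]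
    {x₀ : X} (hx₀ : ‖x₀‖ = 1) {U : Set X} (hU : U ∈ 𝓝 x₀) :
    μH[(Module.finrank ℝ X : ℝ) - 1] (sphere (0 : X) 1 ∩ U) ≠ 0 := by
  intro h0
  obtain ⟨φ, hφ⟩ := exists_mem_suppFn hx₀
  have hv := hφ.2
  obtain ⟨P, hP⟩ := exists_ker_projection φ hv
  have hd : 0 ≤ (Module.finrank ℝ X : ℝ) - 1 := by
    rw [← finrank_ker_eq_sub_one φ hv]; positivity
  have hsmooth : ContDiffAt ℝ 1 (fun x => (φ x)⁻¹ • P x) x₀ :=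
    (φ.contDiff.contDiffAt.inv (by simp [hv])).smul P.contDiff.contDiffAt
  obtain ⟨K, t, ht, hK⟩ := hsmooth.exists_lipschitzOnWith
  have himage : μH[(Module.finrank ℝ X : ℝ) - 1]
      ((fun x => (φ x)⁻¹ • P x) '' (sphere (0 : X) 1 ∩ U ∩ t)) = 0 := by
    have := (hK.mono (s := sphere (0 : X) 1 ∩ U ∩ t) inter_subset_right).hausdorffMeasure_image_le
      hd
    rw [measure_mono_null inter_subset_left h0, mul_zero] at this
    exact nonpos_iff_eq_zero.1 this
  have hcont : ContinuousAt
      (fun h : LinearMap.ker (φ : X →ₗ[ℝ] ℝ) => unitDir (x₀ + (h : X))) 0 := by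
    unfold unitDir
    refine ContinuousAt.smul (ContinuousAt.inv₀ (by fun_prop) ?_) (by fun_prop)
    simp [hx₀]
  have hnear : (fun h : LinearMap.ker (φ : X →ₗ[ℝ] ℝ) => unitDir (x₀ + (h : X))) ⁻¹' (U ∩ t)
      ∈ 𝓝 0 := by
    refine hcont ?_
    simpa [unitDir, hx₀] using And.intro hU ht
  rw [← finrank_ker_eq_sub_one φ hv] at himage
  refine (Measure.measure_pos_of_mem_nhds _ hnear).ne' (measure_mono_null (fun h hh => ?_) himage)
  have hφh : φ (h : X) = 0 := h.2
  have hφ1 : φ (x₀ + h) = 1 := by rw [map_add, hv, hφh, add_zero]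
  have hne : x₀ + (h : X) ≠ 0 := fun h0 => by simp [h0] at hφ1
  refine ⟨unitDir (x₀ + h), ⟨⟨mem_sphere_zero_iff_norm.2 (norm_unitDir hne), hh.1⟩, hh.2⟩, ?_⟩
  have hn : ‖x₀ + (h : X)‖ ≠ 0 := norm_ne_zero_iff.2 hne
  have hPh : P (x₀ + h) = h := by
    ext
    rw [hP, hφ1, one_smul, add_sub_cancel_left]
  simp only [unitDir, map_smul, hφ1, hPh, smul_eq_mul, mul_one, inv_inv, smul_smul]
  rw [mul_inv_cancel₀ hn, one_smul]

/-- A sphere isometry `f` maps `D_y` into `D_{f y}` at points with smooth image. -/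
theorem norm_add_lt_two_of_isometry {X E : Type*} [NormedAddCommGroup X] [NormedSpace ℝ X]
    [NormedAddCommGroup E] [NormedSpace ℝ E] {f : X → E}
    (hf : MapsTo f (sphere (0 : X) 1) (sphere (0 : E) 1))
    (hiso : ∀ x ∈ sphere (0 : X) 1, ∀ x' ∈ sphere (0 : X) 1, ‖f x - f x'‖ = ‖x - x'‖)
    {x y : X} (hx : x ∈ sphere (0 : X) 1) (hy : y ∈ sphere (0 : X) 1)
    (hsm : IsSmoothPt (f x)) (hxy : ‖x + y‖ < 2) : ‖f x + f y‖ < 2 := by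
  by_contra! hge
  have hnorm : ∀ z ∈ sphere (0 : X) 1, ‖f z‖ = 1 := fun z hz => mem_sphere_zero_iff_norm.1 (hf hz)
  obtain ⟨g, hg⟩ := hsm
  have supp : ∀ w : E, ‖w‖ = 1 → 2 ≤ ‖f x + w‖ → g w = 1 := by
    intro w hw h2
    obtain ⟨k, hk, hkw⟩ := exists_dual_vector ℝ (f x + w) (by linarith)
    have h1 : ∀ z, k z ≤ ‖z‖ := fun z => by
      have := k.le_opNorm z
      rw [hk, one_mul] at this
      exact (le_abs_self _).trans this
    have hsum : k (f x) + k w = ‖f x + w‖ := by rw [← map_add]; exact hkw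
    have ha := h1 (f x)
    have hb := h1 w
    rw [hnorm x hx] at ha
    rw [hw] at hb
    have hkg : k = g := by
      have : k ∈ suppFn E (f x) := ⟨hk, by linarith⟩
      rwa [hg] at this
    rw [← hkg]
    linarith
  have hx' : -x ∈ sphere (0 : X) 1 := by simpa using hx
  have h1 : g (f y) = 1 := supp _ (hnorm y hy) hge
  have h2 : g (-f (-x)) = 1 := by
    refine supp _ (by rw [norm_neg, hnorm _ hx']) ?_
    rw [← sub_eq_add_neg, hiso x hx _ hx', sub_neg_eq_add, ← two_smul ℝ, norm_smul,
      mem_sphere_zero_iff_norm.1 hx]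
    norm_num
  have hgm : g ∈ suppFn E (f x) := by rw [hg]; rfl
  have h3 := apply_le_norm_of_mem_suppFn hgm (f y - f (-x))
  rw [hiso y hy _ hx', sub_neg_eq_add, add_comm y, sub_eq_add_neg, map_add, h1, h2] at h3
  linarith

/-- **Lemma 2+.** `D_y \ W_y` is negligible in `D_y` (zero `(m-1)`-dimensional Hausdorff
measure); in particular `W_y` is dense in `D_y`. -/
theorem lemma2plus {X E : Type*} [NormedAddCommGroup X] [NormedSpace ℝ X]
    [FiniteDimensional ℝ X] [MeasurableSpace X] [BorelSpace X]
    [NormedAddCommGroup E] [NormedSpace ℝ E] [FiniteDimensional ℝ E]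
    (hdim : Module.finrank ℝ X = Module.finrank ℝ E)
    (f : X → E) (hbij : Set.BijOn f (sphere (0 : X) 1) (sphere (0 : E) 1))
    (hiso : ∀ x ∈ sphere (0 : X) 1, ∀ x' ∈ sphere (0 : X) 1, ‖f x - f x'‖ = ‖x - x'‖)
    (y : X) (hy : y ∈ sphere (0 : X) 1) :
    μH[(Module.finrank ℝ X : ℝ) - 1] (Dset y \ Wset f y) = 0 ∧
      Dset y ⊆ closure (Wset f y) := by
  have hnull : μH[(Module.finrank ℝ X : ℝ) - 1] (Dset y \ Wset f y) = 0 := by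
    let : MeasurableSpace E := borel E
    have : BorelSpace E := ⟨rfl⟩
    have hy1 : ‖y‖ = 1 := mem_sphere_zero_iff_norm.1 hy
    have hfy : ‖f y‖ = 1 := mem_sphere_zero_iff_norm.1 (hbij.mapsTo hy)
    have hd : 0 ≤ (Module.finrank ℝ X : ℝ) - 1 := by
      have : Nontrivial X := ⟨y, 0, fun h => by simp [h] at hy1⟩
      have : 1 ≤ Module.finrank ℝ X := Module.finrank_pos
      have : (1 : ℝ) ≤ Module.finrank ℝ X := by exact_mod_cast this
      linarith
    have hpre : ∀ T : Set E, μH[(Module.finrank ℝ X : ℝ) - 1] T = 0 →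
        μH[(Module.finrank ℝ X : ℝ) - 1] (sphere (0 : X) 1 ∩ f ⁻¹' T) = 0 := by
      intro T hT
      refine hausdorffMeasure_eq_zero_of_dist_le_mul hd zero_le_one (F := f) ?_
        (fun x hx => hx.2) hT
      intro x hx x' hx'
      rw [one_mul, dist_eq_norm, dist_eq_norm, hiso x hx.1 x' hx'.1]
    have hX := hausdorffMeasure_not_isSmoothPt_unitDir_sub hy1.le
    have hE := hausdorffMeasure_not_isSmoothPt_unitDir_sub hfy.le
    have hE0 := hausdorffMeasure_not_isSmoothPt_unitDir_sub (y := (0 : E)) (by simp)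
    rw [← hdim] at hE hE0
    refine measure_mono_null ?_ (measure_union_null hX
      (measure_union_null (hpre _ hE) (hpre _ hE0)))
    rintro x ⟨hxD, hxW⟩
    by_cases h1 : IsSmoothPt (unitDir (x - y))
    · right
      have h2 : ¬ IsSmoothPt (unitDir (f x - f y)) := fun h2 => hxW ⟨hxD, h1, h2⟩
      have hfx := hbij.mapsTo hxD.1
      have hfx1 := mem_sphere_zero_iff_norm.1 hfx
      by_cases h3 : IsSmoothPt (f x)
      · exact Or.inl ⟨hxD.1,
          ⟨hfx, norm_add_lt_two_of_isometry hbij.mapsTo hiso hxD.1 hy h3 hxD.2⟩, h2⟩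
      · refine Or.inr ⟨hxD.1, ⟨hfx, ?_⟩, ?_⟩
        · rw [add_zero, hfx1]; norm_num
        · simpa [unitDir, hfx1] using h3
    · exact Or.inl ⟨hxD, h1⟩
  refine ⟨hnull, fun x₀ hx₀ => ?_⟩
  by_contra hcl
  have hU : {x | ‖x + y‖ < 2} ∩ (closure (Wset f y))ᶜ ∈ 𝓝 x₀ :=
    ((isOpen_lt (by fun_prop) (by fun_prop)).inter isClosed_closure.isOpen_compl).mem_nhds
      ⟨hx₀.2, hcl⟩
  refine hausdorffMeasure_sphere_inter_ne_zero (mem_sphere_zero_iff_norm.1 hx₀.1) hU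
    (measure_mono_null ?_ hnull)
  rintro x ⟨hxS, hxy, hxc⟩
  exact ⟨⟨hxS, hxy⟩, fun hxW => hxc (subset_closure hxW)⟩
end
end

section
/- Let X and E be finite-dimensional real normed spaces and f : S_X → S_E a bijective isometry. For every y ∈ S_X, the set {γ((x − y)/‖x − y‖) : x ∈ W_y} is total over X (i.e. for every nonzero z ∈ X some member of the set does not vanish at z), and the set {γ((f(x) − f(y))/‖f(x) − f(y)‖) : x ∈ W_y} is total over E. -/
open Filter Topology Metric Set MeasureTheory

noncomputable section

section NormedGroup

variable {X E : Type*} [NormedAddCommGroup X] [NormedAddCommGroup E]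

/-- The star of `c`, i.e. the set of unit vectors `u` with `‖c + u‖ = 2`, is contained
in a single face of the unit ball. -/
def IsFlatStar (c : X) : Prop :=
  ∀ u v : X, ‖u‖ = 1 → ‖v‖ = 1 → ‖c + u‖ = 2 → ‖c + v‖ = 2 → ‖u + v‖ = 2

lemma IsFlatStar.neg {c : X} (h : IsFlatStar c) : IsFlatStar (-c) := by
  intro u v hu hv h1 h2
  have key := h (-u) (-v) (by simpa) (by simpa) (by rw [← h1, ← norm_neg]; congr 1; abel)
    (by rw [← h2, ← norm_neg]; congr 1; abel)
  rw [← key, ← norm_neg]; congr 1; abel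

lemma norm_map_add_neg_of_isometry {f : X → E}
    (hiso : ∀ x ∈ sphere (0 : X) 1, ∀ x' ∈ sphere (0 : X) 1, ‖f x - f x'‖ = ‖x - x'‖)
    {x x' : X} (hx : ‖x‖ = 1) (hx' : ‖x'‖ = 1) : ‖f x + -f x'‖ = ‖x + -x'‖ := by
  rw [← sub_eq_add_neg, ← sub_eq_add_neg]
  exact hiso x (by simpa) x' (by simpa)

end NormedGroup

section NormedSpace

variable {X E : Type*} [NormedAddCommGroup X] [NormedSpace ℝ X]
  [NormedAddCommGroup E] [NormedSpace ℝ E]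

lemma ContinuousLinearMap.apply_le_norm_of_norm_le_one {g : X →L[ℝ] ℝ} (hg : ‖g‖ ≤ 1) (v : X) :
    g v ≤ ‖v‖ :=
  (le_abs_self _).trans ((g.le_of_opNorm_le hg v).trans_eq (one_mul _))

/-- Unit vectors `u`, `v` with `‖u + v‖ = 2` have a common support functional. -/
lemma exists_mem_suppFn_inter {u v : X} (hu : ‖u‖ = 1) (hv : ‖v‖ = 1) (h : ‖u + v‖ = 2) :
    ∃ g, g ∈ suppFn X u ∧ g ∈ suppFn X v := by
  obtain ⟨g, hg, hgv⟩ := exists_dual_vector ℝ (u + v) (by rw [h]; norm_num)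
  have h1 := ContinuousLinearMap.apply_le_norm_of_norm_le_one hg.le u
  have h2 := ContinuousLinearMap.apply_le_norm_of_norm_le_one hg.le v
  simp only [map_add, h, RCLike.ofReal_real_eq_id, id] at hgv
  exact ⟨g, ⟨hg, by linarith⟩, ⟨hg, by linarith⟩⟩

lemma norm_add_eq_two_of_mem_suppFn {u v : X} (hu : ‖u‖ = 1) (hv : ‖v‖ = 1) {g : X →L[ℝ] ℝ}
    (h1 : g ∈ suppFn X u) (h2 : g ∈ suppFn X v) : ‖u + v‖ = 2 := by
  have h3 := ContinuousLinearMap.apply_le_norm_of_norm_le_one h1.1.le (u + v)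
  have h4 := norm_add_le u v
  rw [map_add, h1.2, h2.2] at h3
  linarith

/-- If one interior point of a segment joining two points of the closed unit ball has norm
less than one, then so do all interior points. -/
lemma norm_combo_lt_one {u v : X} (hu : ‖u‖ ≤ 1) (hv : ‖v‖ ≤ 1) {s t : ℝ}
    (ht0 : 0 < t) (ht1 : t < 1)
    (h : ‖u + s • (v - u)‖ < 1) : ‖u + t • (v - u)‖ < 1 := by
  by_contra! hc
  obtain ⟨g, hg, hgv⟩ := exists_dual_vector ℝ (u + t • (v - u)) (by linarith)
  have h1 := ContinuousLinearMap.apply_le_norm_of_norm_le_one hg.le u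
  have h2 := ContinuousLinearMap.apply_le_norm_of_norm_le_one hg.le v
  have h3 := ContinuousLinearMap.apply_le_norm_of_norm_le_one hg.le (u + s • (v - u))
  simp only [map_add, map_smul, map_sub, smul_eq_mul, RCLike.ofReal_real_eq_id, id] at hgv h3
  have hgu : g u = 1 := by nlinarith
  have hgv : g v = 1 := by nlinarith
  rw [hgu, hgv] at h3
  linarith

/-! ### Stars of points of the unit sphere -/

lemma suppFn_midpoint {c d : X} (hc : ‖c‖ = 1) (hd : ‖d‖ = 1) :
    suppFn X ((2⁻¹ : ℝ) • (c + d)) = suppFn X c ∩ suppFn X d := by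
  ext g
  constructor
  · rintro ⟨hg, hgv⟩
    have h1 := ContinuousLinearMap.apply_le_norm_of_norm_le_one hg.le c
    have h2 := ContinuousLinearMap.apply_le_norm_of_norm_le_one hg.le d
    simp only [map_smul, map_add, smul_eq_mul] at hgv
    exact ⟨⟨hg, by linarith⟩, ⟨hg, by linarith⟩⟩
  · rintro ⟨⟨hg, h1⟩, ⟨-, h2⟩⟩
    refine ⟨hg, ?_⟩
    simp only [map_smul, map_add, smul_eq_mul, h1, h2]
    norm_num

lemma exists_isFlatStar [FiniteDimensional ℝ X] {c₀ : X} (hc₀ : ‖c₀‖ = 1) :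
    ∃ c : X, ‖c‖ = 1 ∧ suppFn X c ⊆ suppFn X c₀ ∧ IsFlatStar c := by
  have hex : ∃ n : ℕ, ∃ c : X, ‖c‖ = 1 ∧ suppFn X c ⊆ suppFn X c₀ ∧
      Module.finrank ℝ (Submodule.span ℝ (suppFn X c)) = n := ⟨_, c₀, hc₀, subset_rfl, rfl⟩
  classical
  obtain ⟨c, hc, hsub, hn⟩ := Nat.find_spec hex
  refine ⟨c, hc, hsub, ?_⟩
  have key : ∀ d : X, ‖d‖ = 1 → ‖c + d‖ = 2 → suppFn X c ⊆ suppFn X d := by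
    intro d hd hcd
    have hm := suppFn_midpoint hc hd
    have hle : suppFn X ((2⁻¹ : ℝ) • (c + d)) ⊆ suppFn X c := hm ▸ inter_subset_left
    have hmin := Nat.find_min' hex
      ⟨(2⁻¹ : ℝ) • (c + d), by rw [norm_smul, hcd]; norm_num, hle.trans hsub, rfl⟩
    rw [← hn] at hmin
    have heq := Submodule.eq_of_le_of_finrank_le (Submodule.span_mono hle) hmin
    have hlin : ∀ h ∈ Submodule.span ℝ (suppFn X ((2⁻¹ : ℝ) • (c + d))), h c = h d := by
      intro h hh
      induction hh using Submodule.span_induction with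
      | mem h hh => rw [hm] at hh; rw [hh.1.2, hh.2.2]
      | zero => simp
      | add a b _ _ ha hb => simp [ha, hb]
      | smul r a _ ha => simp [ha]
    intro g hg
    refine ⟨hg.1, ?_⟩
    rw [← hlin g (heq ▸ Submodule.subset_span hg), hg.2]
  intro u v hu hv h1 h2
  obtain ⟨g, hgc, hgu⟩ := exists_mem_suppFn_inter hc hu h1
  exact norm_add_eq_two_of_mem_suppFn hu hv hgu (key v hv h2 hgc)

lemma IsFlatStar.map [FiniteDimensional ℝ E] {f : X → E}
    (hbij : Set.BijOn f (sphere (0 : X) 1) (sphere (0 : E) 1))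
    (hiso : ∀ x ∈ sphere (0 : X) 1, ∀ x' ∈ sphere (0 : X) 1, ‖f x - f x'‖ = ‖x - x'‖)
    {c : X} (hc : ‖c‖ = 1) (hflat : IsFlatStar c) : IsFlatStar (f c) := by
  have hmap : ∀ x : X, ‖x‖ = 1 → ‖f x‖ = 1 := fun x hx => by
    simpa using hbij.mapsTo (show x ∈ sphere (0 : X) 1 by simpa)
  have hsurj : ∀ e : E, ‖e‖ = 1 → ∃ x : X, ‖x‖ = 1 ∧ f x = e := fun e he => by
    obtain ⟨x, hx, hxe⟩ := hbij.surjOn (show e ∈ sphere (0 : E) 1 by simpa)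
    exact ⟨x, by simpa using hx, hxe⟩
  have hd := fun {x x' : X} => norm_map_add_neg_of_isometry hiso (x := x) (x' := x')
  obtain ⟨e, he, hsub, heflat⟩ := exists_isFlatStar (hmap c hc)
  obtain ⟨w, hw, rfl⟩ := hsurj e he
  have hstar : ∀ u : X, ‖u‖ = 1 → ‖w + u‖ = 2 → ‖c + u‖ = 2 := by
    intro u hu h
    have hu' : ‖-u‖ = 1 := by simpa
    have h1 : ‖f w + -f (-u)‖ = 2 := by rw [hd hw hu', neg_neg, h]
    have hn : ‖-f (-u)‖ = 1 := by rw [norm_neg]; exact hmap _ hu'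
    obtain ⟨g, hg, hgu⟩ := exists_mem_suppFn_inter he hn h1
    have h2 := norm_add_eq_two_of_mem_suppFn (hmap c hc) hn (hsub hg) hgu
    rwa [hd hc hu', neg_neg] at h2
  have hcw : ‖c + w‖ = 2 := hstar w hw (by rw [← two_smul ℝ, norm_smul, hw]; norm_num)
  have hstar' : ∀ u : E, ‖u‖ = 1 → ‖f c + u‖ = 2 → ‖f w + u‖ = 2 := by
    intro u hu h
    obtain ⟨a, ha, hau⟩ := hsurj (-u) (by simpa)
    obtain rfl : u = -f a := by rw [hau, neg_neg]
    rw [hd hc ha] at h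
    rw [hd hw ha]
    exact hflat w (-a) hw (by simpa) hcw h
  intro u v hu hv h1 h2
  exact heflat u v hu hv (hstar' u hu h1) (hstar' v hv h2)

/-- A surjective isometry between unit spheres preserves the relation `‖x + y‖ = 2`. -/
lemma norm_map_add_eq_two [FiniteDimensional ℝ X] [FiniteDimensional ℝ E] {f : X → E}
    (hbij : Set.BijOn f (sphere (0 : X) 1) (sphere (0 : E) 1))
    (hiso : ∀ x ∈ sphere (0 : X) 1, ∀ x' ∈ sphere (0 : X) 1, ‖f x - f x'‖ = ‖x - x'‖)
    {x y : X} (hx : ‖x‖ = 1) (hy : ‖y‖ = 1) (h : ‖x + y‖ = 2) : ‖f x + f y‖ = 2 := by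
  have hmap : ∀ x : X, ‖x‖ = 1 → ‖f x‖ = 1 := fun x hx => by
    simpa using hbij.mapsTo (show x ∈ sphere (0 : X) 1 by simpa)
  obtain ⟨c, hc, hsub, hflat⟩ :=
    exists_isFlatStar (c₀ := (2⁻¹ : ℝ) • (x + y)) (by rw [norm_smul, h]; norm_num)
  rw [suppFn_midpoint hx hy] at hsub
  have hc' : ‖-c‖ = 1 := by simpa
  obtain ⟨g, hg, hgc⟩ := exists_dual_vector ℝ c (by rw [hc]; norm_num)
  have hgc' : g ∈ suppFn X c := ⟨hg, by simpa [hc] using hgc⟩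
  have key : ∀ u : X, ‖u‖ = 1 → g ∈ suppFn X u → ‖f (-c) + -f u‖ = 2 := by
    intro u hu hgu
    rw [norm_map_add_neg_of_isometry hiso hc' hu, ← neg_add, norm_neg]
    exact norm_add_eq_two_of_mem_suppFn hc hu hgc' hgu
  have := hflat.neg.map hbij hiso hc' (-f x) (-f y) (by rw [norm_neg, hmap x hx])
    (by rw [norm_neg, hmap y hy]) (key x hx (hsub hgc').1) (key y hy (hsub hgc').2)
  rwa [← neg_add, norm_neg] at this

/-- Surjective isometries of unit spheres send `D_y` onto `D_{f y}`. -/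
lemma bijOn_Dset [FiniteDimensional ℝ X] [FiniteDimensional ℝ E] {f : X → E}
    (hbij : Set.BijOn f (sphere (0 : X) 1) (sphere (0 : E) 1))
    (hiso : ∀ x ∈ sphere (0 : X) 1, ∀ x' ∈ sphere (0 : X) 1, ‖f x - f x'‖ = ‖x - x'‖)
    {y : X} (hy : y ∈ sphere (0 : X) 1) : Set.BijOn f (Dset y) (Dset (f y)) := by
  have hfy := hbij.mapsTo hy
  refine ⟨?_, hbij.injOn.mono fun x hx => hx.1, ?_⟩
  · rintro x ⟨hx, hxy⟩
    have hfx := hbij.mapsTo hx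
    refine ⟨hfx, lt_of_le_of_ne ?_ fun h => hxy.ne ?_⟩
    · refine (norm_add_le _ _).trans ?_
      rw [mem_sphere_zero_iff_norm] at hfx hfy
      linarith
    · have hinv := hbij.invOn_invFunOn
      have hbij' := Set.BijOn.symm hinv.symm hbij
      have hiso' : ∀ e ∈ sphere (0 : E) 1, ∀ e' ∈ sphere (0 : E) 1,
          ‖Function.invFunOn f (sphere (0 : X) 1) e - Function.invFunOn f (sphere (0 : X) 1) e'‖
            = ‖e - e'‖ := by
        intro e he e' he'
        rw [← hiso _ (hbij'.mapsTo he) _ (hbij'.mapsTo he'), hinv.2 he, hinv.2 he']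
      have := norm_map_add_eq_two hbij' hiso' (by simpa using hfx) (by simpa using hfy) h
      rwa [hinv.1 hx, hinv.1 hy] at this
  · rintro e ⟨he, hey⟩
    obtain ⟨x, hx, rfl⟩ := hbij.surjOn he
    refine ⟨x, ⟨hx, lt_of_le_of_ne ?_ fun h => hey.ne ?_⟩, rfl⟩
    · refine (norm_add_le _ _).trans ?_
      rw [mem_sphere_zero_iff_norm] at hx hy
      linarith
    · exact norm_map_add_eq_two hbij hiso (by simpa using hx) (by simpa using hy) h

/-! ### Directions from a point of the sphere -/

lemma ne_of_mem_Dset {x y : X} (hy : ‖y‖ = 1) (hx : x ∈ Dset y) : x ≠ y := by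
  rintro rfl
  have := hx.2
  rw [← two_smul ℝ, norm_smul, hy] at this
  norm_num at this

lemma exists_exit_mem_Dset {y d : X} (hy : ‖y‖ = 1) {s t : ℝ} (hs : 0 < s) (hst : s ≤ t)
    (h1 : ‖y + s • d‖ < 1) (h2 : 1 ≤ ‖y + t • d‖) :
    ∃ r ∈ Set.Icc s t, y + r • d ∈ Dset y := by
  have hcont : ContinuousOn (fun r : ℝ => ‖y + r • d‖) (Set.Icc s t) := by fun_prop
  obtain ⟨r, hr, hr1⟩ := intermediate_value_Icc hst hcont ⟨h1.le, h2⟩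
  refine ⟨r, hr, by simpa using hr1, ?_⟩
  have hr0 : 0 < r := hs.trans_le hr.1
  have key := norm_combo_lt_one (u := y) (v := y + r • d) hy.le hr1.le (s := s / r) (t := 2⁻¹)
    (by norm_num) (by norm_num)
    (by rwa [add_sub_cancel_left, smul_smul, div_mul_cancel₀ _ hr0.ne'])
  have : y + r • d + y = (2 : ℝ) • (y + (2⁻¹ : ℝ) • (y + r • d - y)) := by module
  rw [this, norm_smul, Real.norm_of_nonneg zero_le_two]
  linarith

lemma norm_add_smul_lt_one_of_mem_Dset {x y : X} (hy : ‖y‖ = 1) (hx : x ∈ Dset y) {t : ℝ}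
    (h0 : 0 < t) (h1 : t < 1) : ‖y + t • (x - y)‖ < 1 := by
  refine norm_combo_lt_one hy.le (mem_sphere_zero_iff_norm.1 hx.1).le (s := 2⁻¹)
    h0 h1 ?_
  have : y + (2⁻¹ : ℝ) • (x - y) = (2⁻¹ : ℝ) • (x + y) := by module
  rw [this, norm_smul, Real.norm_of_nonneg (by norm_num)]
  linarith [hx.2]

lemma one_lt_norm_add_smul_of_mem_Dset {x y : X} (hy : ‖y‖ = 1) (hx : x ∈ Dset y) {t : ℝ}
    (h1 : 1 < t) : 1 < ‖y + t • (x - y)‖ := by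
  by_contra! hc
  have ht : 0 < t := by linarith
  have := norm_combo_lt_one (u := y) (v := y + t • (x - y)) hy.le hc (s := 2⁻¹ * t⁻¹) (t := t⁻¹)
    (by positivity) (inv_lt_one_of_one_lt₀ h1) ?_
  · rw [add_sub_cancel_left, smul_smul, inv_mul_cancel₀ ht.ne', one_smul, add_sub_cancel,
      mem_sphere_zero_iff_norm.1 hx.1] at this
    exact lt_irrefl _ this
  · rw [add_sub_cancel_left, smul_smul, mul_assoc, inv_mul_cancel₀ ht.ne', mul_one]
    exact norm_add_smul_lt_one_of_mem_Dset hy hx (by norm_num) (by norm_num)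

/-- If a dense subset `O` of `X` is stable under positive dilations, then the points `x` of `D_y`
with `x - y ∈ O` are dense in `D_y`. -/
lemma exists_mem_Dset_sub_mem {O : Set X} (hO : Dense O)
    (hcone : ∀ v ∈ O, ∀ r : ℝ, 0 < r → r • v ∈ O) {x y : X} (hy : ‖y‖ = 1) (hx : x ∈ Dset y)
    {ε : ℝ} (hε : 0 < ε) : ∃ x' ∈ Dset y, ‖x' - x‖ < ε ∧ x' - y ∈ O := by
  have hlim : Tendsto (fun p : ℝ × X => ‖y + p.1 • p.2 - x‖) (𝓝 (1, x - y)) (𝓝 0) := by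
    have : Continuous (fun p : ℝ × X => ‖y + p.1 • p.2 - x‖) := by fun_prop
    simpa using this.tendsto (1, x - y)
  have hev := hlim.eventually (gt_mem_nhds hε)
  rw [nhds_prod_eq] at hev
  obtain ⟨pa, hpa, pb, hpb, hab⟩ := Filter.eventually_prod_iff.1 hev
  obtain ⟨η, hη, hball⟩ := Metric.eventually_nhds_iff.1 hpa
  set θ := min (η / 2) (1 / 2) with hθ
  have hθ0 : 0 < θ := by positivity
  have hθ1 : θ ≤ 1 / 2 := min_le_right _ _
  have hθη : θ ≤ η / 2 := min_le_left _ _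
  have hlow : ∀ᶠ d in 𝓝 (x - y), ‖y + (1 - θ) • d‖ < 1 := by
    have : Continuous (fun d : X => ‖y + (1 - θ) • d‖) := by fun_prop
    exact this.continuousAt.eventually
      (gt_mem_nhds (norm_add_smul_lt_one_of_mem_Dset hy hx (by linarith) (by linarith)))
  have hhigh : ∀ᶠ d in 𝓝 (x - y), 1 < ‖y + (1 + θ) • d‖ := by
    have : Continuous (fun d : X => ‖y + (1 + θ) • d‖) := by fun_prop
    exact this.continuousAt.eventually
      (lt_mem_nhds (one_lt_norm_add_smul_of_mem_Dset hy hx (by linarith)))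
  obtain ⟨d, ⟨⟨hd1, hd2⟩, hd3⟩, hdO⟩ :=
    mem_closure_iff_nhds.1 (hO (x - y)) _ ((hlow.and hhigh).and hpb)
  obtain ⟨r, hr, hrD⟩ := exists_exit_mem_Dset hy (by linarith) (by linarith) hd1 hd2.le
  refine ⟨y + r • d, hrD, hab (hball ?_) hd3, ?_⟩
  · rw [Real.dist_eq, abs_lt]
    constructor <;> linarith [hr.1, hr.2]
  · rw [add_sub_cancel_left]
    exact hcone d hdO r (by linarith [hr.1])

/-- If `z` is annihilated by a support functional of every `x - y` with `x ∈ D_y`,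
then `z = 0`. -/
lemma eq_zero_of_forall_Dset {y z : X} (hy : ‖y‖ = 1)
    (h : ∀ x ∈ Dset y, ∃ g : X →L[ℝ] ℝ, ‖g‖ ≤ 1 ∧ g (x - y) = ‖x - y‖ ∧ g z = 0) : z = 0 := by
  have hV : ∀ d : X, (∃ ε : ℝ, 0 < ε ∧ ‖y + ε • d‖ < 1) → ∀ s : ℝ, ‖d‖ ≤ ‖d + s • z‖ := by
    rintro d ⟨ε, hε, hd⟩ s
    have hd0 : 0 < ‖d‖ := norm_pos_iff.2 fun h0 => by simp [h0, hy] at hd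
    obtain ⟨r, hr, hrD⟩ := exists_exit_mem_Dset hy (t := ε + 2 / ‖d‖) hε
      (by have : 0 < 2 / ‖d‖ := by positivity
          linarith) hd (by
        have h1 : ‖(ε + 2 / ‖d‖) • d‖ ≤ ‖y + (ε + 2 / ‖d‖) • d‖ + ‖y‖ := by
          simpa using norm_sub_le (y + (ε + 2 / ‖d‖) • d) y
        rw [norm_smul, Real.norm_of_nonneg (by positivity), add_mul, div_mul_cancel₀ _ hd0.ne',
          hy] at h1
        have : 0 < ε * ‖d‖ := by positivity
        linarith)
    have hr0 : 0 < r := hε.trans_le hr.1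
    obtain ⟨g, hg, hgd, hgz⟩ := h _ hrD
    rw [add_sub_cancel_left, map_smul, norm_smul, Real.norm_of_nonneg hr0.le, smul_eq_mul] at hgd
    have hgd' := mul_left_cancel₀ hr0.ne' hgd
    have := ContinuousLinearMap.apply_le_norm_of_norm_le_one hg (d + s • z)
    rwa [map_add, map_smul, hgz, smul_zero, add_zero, hgd'] at this
  have hle : ∀ s : ℝ, (∃ ε : ℝ, 0 < ε ∧ ‖y + ε • (-y + s • z)‖ < 1) → ‖-y + s • z‖ ≤ 1 := by
    intro s hs
    have := hV _ hs (-s)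
    rwa [add_assoc, ← add_smul, add_neg_cancel, zero_smul, add_zero, norm_neg, hy] at this
  have hsmall : ∀ s : ℝ, |s| * ‖z‖ < 1 → ‖-y + s • z‖ ≤ 1 := fun s hs =>
    hle s ⟨1, one_pos, by rwa [one_smul, add_neg_cancel_left, norm_smul, Real.norm_eq_abs]⟩
  have hall : ∀ t : ℝ, ‖-y + t • z‖ ≤ 1 := by
    intro t
    set a := |t| * ‖z‖ with ha
    have ha0 : 0 ≤ a := by positivity
    refine hle t ⟨1 / (2 + a), by positivity, ?_⟩
    have hs := hsmall (-(t / (1 + a))) (by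
      rw [abs_neg, abs_div, abs_of_pos (show 0 < 1 + a by positivity), div_mul_eq_mul_div, ← ha,
        div_lt_one (by positivity)]
      linarith)
    have heq : y + (1 / (2 + a)) • (-y + t • z) =
        (-((1 + a) / (2 + a))) • (-y + (-(t / (1 + a))) • z) := by
      have h1 : 1 + a ≠ 0 := by positivity
      have h2 : 2 + a ≠ 0 := by positivity
      match_scalars <;> field_simp
      ring
    rw [heq, norm_smul, norm_neg, Real.norm_of_nonneg (by positivity)]
    have h3 : (1 + a) / (2 + a) < 1 := by rw [div_lt_one (by positivity)]; linarith
    have h4 : 0 ≤ (1 + a) / (2 + a) := by positivity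
    nlinarith [norm_nonneg (-y + (-(t / (1 + a))) • z)]
  by_contra hz
  have hz0 : 0 < ‖z‖ := norm_pos_iff.2 hz
  have h1 := hall (3 / ‖z‖)
  have h2 : ‖(3 / ‖z‖) • z‖ ≤ ‖-y + (3 / ‖z‖) • z‖ + ‖y‖ := by
    simpa using norm_add_le (-y + (3 / ‖z‖) • z) y
  rw [norm_smul, Real.norm_of_nonneg (by positivity), div_mul_cancel₀ _ hz0.ne', hy] at h2
  linarith

lemma isClosed_setOf_exists_annihilating [FiniteDimensional ℝ X] (z : X) :
    IsClosed {v : X | ∃ g : X →L[ℝ] ℝ, ‖g‖ ≤ 1 ∧ g v = ‖v‖ ∧ g z = 0} := by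
  have : CompactSpace (closedBall (0 : X →L[ℝ] ℝ) 1) :=
    isCompact_iff_compactSpace.1 (isCompact_closedBall _ _)
  have hcl : IsClosed {p : closedBall (0 : X →L[ℝ] ℝ) 1 × X |
      (p.1 : X →L[ℝ] ℝ) p.2 = ‖p.2‖ ∧ (p.1 : X →L[ℝ] ℝ) z = 0} := by
    refine (isClosed_eq ?_ ?_).inter (isClosed_eq ?_ ?_) <;> fun_prop
  convert isClosedMap_snd_of_compactSpace _ hcl using 1
  ext v
  constructor
  · rintro ⟨g, hg, h1, h2⟩
    exact ⟨(⟨g, by simpa using hg⟩, v), ⟨h1, h2⟩, rfl⟩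
  · rintro ⟨⟨⟨g, hg⟩, v'⟩, ⟨h1, h2⟩, rfl⟩
    exact ⟨g, by simpa using hg, h1, h2⟩

lemma apply_unitDir_eq_one_iff {g : X →L[ℝ] ℝ} {v : X} (hv : v ≠ 0) :
    g (unitDir v) = 1 ↔ g v = ‖v‖ := by
  rw [unitDir, map_smul, smul_eq_mul, inv_mul_eq_one₀ (norm_ne_zero_iff.2 hv), eq_comm]

/-- Support functionals at smooth directions from `y` to a dense subset of `D_y` are total. -/
lemma total_of_dense_Dset [FiniteDimensional ℝ X] {y : X} (hy : ‖y‖ = 1) {A : Set X}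
    (hA : A ⊆ Dset y) (hdense : Dset y ⊆ closure A)
    (hsmooth : ∀ x ∈ A, IsSmoothPt (unitDir (x - y))) {z : X} (hz : z ≠ 0) :
    ∃ x ∈ A, ∃ g : X →L[ℝ] ℝ, suppFn X (unitDir (x - y)) = {g} ∧ g z ≠ 0 := by
  by_contra! hcon
  refine hz (eq_zero_of_forall_Dset hy fun x hx => ?_)
  have hcl := (isClosed_setOf_exists_annihilating z).preimage
    (show Continuous fun x : X => x - y by fun_prop)
  refine (closure_minimal ?_ hcl) (hdense hx)
  intro a ha
  obtain ⟨g, hg⟩ := hsmooth a ha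
  have hmem : g ∈ suppFn X (unitDir (a - y)) := hg ▸ mem_singleton g
  exact ⟨g, hmem.1.le, (apply_unitDir_eq_one_iff
    (sub_ne_zero.2 (ne_of_mem_Dset hy (hA ha)))).1 hmem.2, hcon a ha g hg⟩

/-! ### Smooth points are residual -/

/-- The set of points where the second difference quotient of the norm in direction `w`
is smaller than `ε` for some step. -/
def almostSmooth (w : X) (ε : ℝ) : Set X :=
  {v | ∃ δ : ℝ, 0 < δ ∧ ‖v + δ • w‖ + ‖v - δ • w‖ - 2 * ‖v‖ < ε * δ}

lemma isOpen_almostSmooth (w : X) (ε : ℝ) : IsOpen (almostSmooth w ε) := by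
  have : almostSmooth w ε = ⋃ δ : ℝ, ⋃ _ : 0 < δ,
      {v | ‖v + δ • w‖ + ‖v - δ • w‖ - 2 * ‖v‖ < ε * δ} := by
    ext v; simp [almostSmooth]
  rw [this]
  exact isOpen_iUnion fun δ => isOpen_iUnion fun _ => isOpen_lt (by fun_prop) (by fun_prop)

lemma smul_mem_almostSmooth {w : X} {ε : ℝ} {v : X} (hv : v ∈ almostSmooth w ε) {r : ℝ}
    (hr : 0 < r) : r • v ∈ almostSmooth w ε := by
  obtain ⟨δ, hδ, h⟩ := hv
  refine ⟨r * δ, by positivity, ?_⟩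
  rw [mul_smul, ← smul_add, ← smul_sub, norm_smul, norm_smul, norm_smul,
    Real.norm_of_nonneg hr.le]
  nlinarith

lemma dense_almostSmooth [FiniteDimensional ℝ X] (w : X) {ε : ℝ} (hε : 0 < ε) :
    Dense (almostSmooth w ε) := by
  refine dense_differentiableAt_norm.mono fun v hv => ?_
  have hd := DifferentiableAt.hasFDerivAt hv
  have h1 := hd.lim_real w
  have h2 := hd.lim_real (-w)
  have h3 := h1.add h2
  rw [map_neg, add_neg_cancel] at h3
  obtain ⟨c, hc, hc0⟩ := ((h3.eventually (gt_mem_nhds hε)).and (eventually_gt_atTop 0)).exists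
  refine ⟨c⁻¹, by positivity, ?_⟩
  rw [← div_eq_mul_inv, lt_div_iff₀ hc0]
  simp only [smul_eq_mul, smul_neg, ← sub_eq_add_neg] at hc
  linarith

lemma isSmoothPt_unitDir {ι : Type*} (b : Module.Basis ι ℝ X) {v : X} (hv : v ≠ 0)
    (h : ∀ (i : ι) (n : ℕ), v ∈ almostSmooth (b i) (1 / ((n : ℝ) + 1))) :
    IsSmoothPt (unitDir v) := by
  have key : ∀ g ∈ suppFn X (unitDir v), ∀ g' ∈ suppFn X (unitDir v), ∀ i,
      g (b i) ≤ g' (b i) := by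
    intro g hg g' hg' i
    refine le_of_forall_pos_lt_add fun ε hε => ?_
    obtain ⟨n, hn⟩ := exists_nat_one_div_lt hε
    obtain ⟨δ, hδ, hlt⟩ := h i n
    have h1 := ContinuousLinearMap.apply_le_norm_of_norm_le_one hg.1.le (v + δ • b i)
    have h2 := ContinuousLinearMap.apply_le_norm_of_norm_le_one hg'.1.le (v - δ • b i)
    rw [map_add, map_smul, smul_eq_mul, (apply_unitDir_eq_one_iff hv).1 hg.2] at h1
    rw [map_sub, map_smul, smul_eq_mul, (apply_unitDir_eq_one_iff hv).1 hg'.2] at h2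
    have h3 : δ * g (b i) < δ * (g' (b i) + 1 / ((n : ℝ) + 1)) := by linarith
    have := lt_of_mul_lt_mul_left h3 hδ.le
    linarith
  obtain ⟨g, hg, hgv⟩ := exists_dual_vector ℝ v (norm_ne_zero_iff.2 hv)
  have hmem : g ∈ suppFn X (unitDir v) := ⟨hg, (apply_unitDir_eq_one_iff hv).2 hgv⟩
  refine ⟨g, eq_singleton_iff_unique_mem.2 ⟨hmem, fun g' hg' => ?_⟩⟩
  refine ContinuousLinearMap.coe_injective (b.ext fun i => ?_)
  exact le_antisymm (key g' hg' g hmem i) (key g hmem g' hg' i)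

lemma locallyCompactSpace_Dset [FiniteDimensional ℝ X] (y : X) :
    LocallyCompactSpace (Dset y) := by
  have hopen : IsOpen {x : X | ‖x + y‖ < 2} := isOpen_lt (by fun_prop) (by fun_prop)
  have : IsLocallyClosed (Dset y) := (isClosed_sphere.isLocallyClosed).inter hopen.isLocallyClosed
  exact this.locallyCompactSpace

lemma Dset_subset_closure_Wset [FiniteDimensional ℝ X] [FiniteDimensional ℝ E] {f : X → E}
    (hbij : Set.BijOn f (sphere (0 : X) 1) (sphere (0 : E) 1))
    (hiso : ∀ x ∈ sphere (0 : X) 1, ∀ x' ∈ sphere (0 : X) 1, ‖f x - f x'‖ = ‖x - x'‖)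
    {y : X} (hy : y ∈ sphere (0 : X) 1) : Dset y ⊆ closure (Wset f y) := by
  have hD := bijOn_Dset hbij hiso hy
  have hy1 : ‖y‖ = 1 := by simpa using hy
  have hfy1 : ‖f y‖ = 1 := by simpa using hbij.mapsTo hy
  have := locallyCompactSpace_Dset y
  let b := Module.finBasis ℝ X
  let b' := Module.finBasis ℝ E
  have hfcont : Continuous fun x : Dset y => f x := by
    refine Isometry.continuous (Isometry.of_dist_eq fun x x' => ?_)
    rw [Subtype.dist_eq, dist_eq_norm, dist_eq_norm, hiso _ x.2.1 _ x'.2.1]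
  let U : Fin _ × ℕ → Set (Dset y) := fun p =>
    {x | (x : X) - y ∈ almostSmooth (b p.1) (1 / ((p.2 : ℝ) + 1))}
  let U' : Fin _ × ℕ → Set (Dset y) := fun p =>
    {x | f x - f y ∈ almostSmooth (b' p.1) (1 / ((p.2 : ℝ) + 1))}
  have hUo : ∀ p, IsOpen (U p) := fun p =>
    (isOpen_almostSmooth _ _).preimage (by fun_prop)
  have hUo' : ∀ p, IsOpen (U' p) := fun p =>
    (isOpen_almostSmooth _ _).preimage (hfcont.sub continuous_const)
  have hUd : ∀ p, Dense (U p) := by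
    refine fun p => Metric.dense_iff.2 fun x ε hε => ?_
    obtain ⟨x', hx', hlt, hmem⟩ := exists_mem_Dset_sub_mem
      (dense_almostSmooth (b p.1) (ε := 1 / ((p.2 : ℝ) + 1)) (by positivity))
      (fun v hv r hr => smul_mem_almostSmooth hv hr) hy1 x.2 hε
    exact ⟨⟨x', hx'⟩, by rwa [mem_ball, Subtype.dist_eq, dist_eq_norm], hmem⟩
  have hUd' : ∀ p, Dense (U' p) := by
    refine fun p => Metric.dense_iff.2 fun x ε hε => ?_
    obtain ⟨e, he, hlt, hmem⟩ := exists_mem_Dset_sub_mem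
      (dense_almostSmooth (b' p.1) (ε := 1 / ((p.2 : ℝ) + 1)) (by positivity))
      (fun v hv r hr => smul_mem_almostSmooth hv hr) hfy1 (hD.mapsTo x.2) hε
    obtain ⟨x', hx', rfl⟩ := hD.surjOn he
    rw [hiso _ hx'.1 _ x.2.1] at hlt
    exact ⟨⟨x', hx'⟩, by rwa [mem_ball, Subtype.dist_eq, dist_eq_norm], hmem⟩
  have hdense : Dense (⋂ p, Sum.elim U U' p) :=
    dense_iInter_of_isOpen (Sum.rec hUo hUo') (Sum.rec hUd hUd')
  have hsub : ∀ x ∈ ⋂ p, Sum.elim U U' p, (x : X) ∈ Wset f y := by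
    intro x hx
    rw [mem_iInter] at hx
    refine ⟨x.2, isSmoothPt_unitDir b (sub_ne_zero.2 (ne_of_mem_Dset hy1 x.2))
      fun i n => hx (Sum.inl (i, n)), isSmoothPt_unitDir b'
      (sub_ne_zero.2 (ne_of_mem_Dset hfy1 (hD.mapsTo x.2))) fun i n => hx (Sum.inr (i, n))⟩
  intro x hx
  have := image_closure_subset_closure_image (continuous_subtype_val (p := (· ∈ Dset y)))
    (mem_image_of_mem _ (hdense ⟨x, hx⟩))
  refine closure_mono ?_ this
  rintro _ ⟨x, hx, rfl⟩
  exact hsub x hx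

end NormedSpace

/-- **Lemma 3, main part.** The sets of support functionals
`{γ((x - y)/‖x - y‖) : x ∈ W_y}` and `{γ((f x - f y)/‖f x - f y‖) : x ∈ W_y}` are total
over `X` and over `E`, respectively. -/
theorem lemma3_total {X E : Type*} [NormedAddCommGroup X] [NormedSpace ℝ X]
    [FiniteDimensional ℝ X] [NormedAddCommGroup E] [NormedSpace ℝ E] [FiniteDimensional ℝ E]
    (f : X → E) (hbij : Set.BijOn f (sphere (0 : X) 1) (sphere (0 : E) 1))
    (hiso : ∀ x ∈ sphere (0 : X) 1, ∀ x' ∈ sphere (0 : X) 1, ‖f x - f x'‖ = ‖x - x'‖)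
    (y : X) (hy : y ∈ sphere (0 : X) 1) :
    (∀ z : X, z ≠ 0 → ∃ x ∈ Wset f y, ∃ g : X →L[ℝ] ℝ,
        suppFn X (unitDir (x - y)) = {g} ∧ g z ≠ 0) ∧
    (∀ e : E, e ≠ 0 → ∃ x ∈ Wset f y, ∃ g : E →L[ℝ] ℝ,
        suppFn E (unitDir (f x - f y)) = {g} ∧ g e ≠ 0) := by
  have hy1 : ‖y‖ = 1 := by simpa using hy
  have hfy1 : ‖f y‖ = 1 := by simpa using hbij.mapsTo hy
  have hD := bijOn_Dset hbij hiso hy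
  have hW := Dset_subset_closure_Wset hbij hiso hy
  have hWD : Wset f y ⊆ Dset y := fun x hx => hx.1
  refine ⟨fun z hz => total_of_dense_Dset hy1 hWD hW (fun x hx => hx.2.1) hz, fun e he => ?_⟩
  have hcl : Dset (f y) ⊆ closure (f '' Wset f y) := by
    intro e he
    obtain ⟨x, hx, rfl⟩ := hD.surjOn he
    refine Metric.mem_closure_iff.2 fun ε hε => ?_
    obtain ⟨x', hx', hlt⟩ := Metric.mem_closure_iff.1 (hW hx) ε hε
    refine ⟨f x', mem_image_of_mem f hx', ?_⟩
    rwa [dist_eq_norm, hiso _ hx.1 _ hx'.1.1, ← dist_eq_norm]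
  obtain ⟨_, ⟨x, hx, rfl⟩, g, hg, hge⟩ := total_of_dense_Dset hfy1
    (image_subset_iff.2 fun x hx => hD.mapsTo (hWD hx)) hcl
    (by rintro _ ⟨x, hx, rfl⟩; exact hx.2.2) he
  exact ⟨x, hx, g, hg, hge⟩
end
end

section
/- Let X and E be finite-dimensional real normed spaces and f : S_X → S_E a bijective isometry. Let y ∈ S_X and let (y_n) be a sequence in S_X \ {y} converging to y such that the sequence ((y − y_n)/‖y − y_n‖) converges. Then the sequence ((f(y) − f(y_n))/‖f(y) − f(y_n)‖) converges as well; moreover, for every x ∈ W_y, ⟨γ((x − y)/‖x − y‖), lim_n (y − y_n)/‖y − y_n‖⟩ = ⟨γ((f(x) − f(y))/‖f(x) − f(y)‖), lim_n (f(y) − f(y_n))/‖f(y) − f(y_n)‖⟩. -/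
open Filter Topology Metric Set MeasureTheory

noncomputable section

/-- The one-sided directional derivative of the norm at `d` in the direction `v`. -/
def normDirDeriv {V : Type*} [NormedAddCommGroup V] [NormedSpace ℝ V] (d v : V) : ℝ :=
  derivWithin (fun t : ℝ => ‖d + t • v‖) (Ioi 0) 0

section NormDirDeriv

variable {V : Type*} [NormedAddCommGroup V] [NormedSpace ℝ V]

theorem convexOn_norm_add_smul (d v : V) : ConvexOn ℝ univ fun t : ℝ => ‖d + t • v‖ := by
  refine ⟨convex_univ, fun s _ t _ a b ha hb hab => ?_⟩
  have h : d + (a • s + b • t) • v = a • (d + s • v) + b • (d + t • v) := by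
    have : d = (a + b) • d := by rw [hab, one_smul]
    nth_rewrite 1 [this]
    simp only [smul_eq_mul]
    module
  calc ‖d + (a • s + b • t) • v‖ ≤ ‖a • (d + s • v)‖ + ‖b • (d + t • v)‖ := by
        rw [h]; exact norm_add_le _ _
    _ = a • ‖d + s • v‖ + b • ‖d + t • v‖ := by
        rw [norm_smul, norm_smul, Real.norm_of_nonneg ha, Real.norm_of_nonneg hb]; rfl

theorem normDirDeriv_le (d v : V) {t : ℝ} (ht : 0 < t) :
    normDirDeriv d v ≤ (‖d + t • v‖ - ‖d‖) / t := by
  have h := (convexOn_norm_add_smul d v).rightDeriv_le_slope_of_mem_interior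
    (x := 0) (by simp) (mem_univ t) ht
  simpa [slope_def_field, normDirDeriv] using h

theorem tendsto_normDirDeriv (d v : V) :
    Tendsto (fun t : ℝ => (‖d + t • v‖ - ‖d‖) / t) (𝓝[>] 0) (𝓝 (normDirDeriv d v)) := by
  have h := (convexOn_norm_add_smul d v).hasDerivWithinAt_rightDeriv_of_mem_interior
    (x := 0) (by simp)
  rw [hasDerivWithinAt_iff_tendsto_slope' (by simp)] at h
  refine h.congr fun t => ?_
  simp [slope_def_field]

/-- The norm is directionally differentiable along varying directions as well. -/
theorem tendsto_normDirDeriv_seq (d : V) {v : V} {t : ℕ → ℝ} {w : ℕ → V} (ht : ∀ n, 0 < t n)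
    (ht0 : Tendsto t atTop (𝓝 0)) (hw : Tendsto w atTop (𝓝 v)) :
    Tendsto (fun n => (‖d + t n • w n‖ - ‖d‖) / t n) atTop (𝓝 (normDirDeriv d v)) := by
  have h1 := (tendsto_normDirDeriv d v).comp
    (tendsto_nhdsWithin_iff.2 ⟨ht0, Eventually.of_forall ht⟩)
  refine tendsto_of_tendsto_of_dist h1 ?_
  refine squeeze_zero (fun _ => dist_nonneg) (fun n => ?_) (tendsto_iff_norm_sub_tendsto_zero.1 hw)
  have h2 : |‖d + t n • v‖ - ‖d + t n • w n‖| ≤ t n * ‖w n - v‖ := by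
    refine (abs_norm_sub_norm_le _ _).trans_eq ?_
    rw [add_sub_add_left_eq_sub, ← smul_sub, norm_smul, Real.norm_of_nonneg (ht n).le,
      norm_sub_rev]
  rw [Real.dist_eq, Function.comp_apply, ← sub_div, sub_sub_sub_cancel_right, abs_div,
    abs_of_pos (ht n), div_le_iff₀ (ht n)]
  linarith

theorem normDirDeriv_add_le (d v w : V) :
    normDirDeriv d (v + w) ≤ normDirDeriv d v + normDirDeriv d w := by
  have h2 : Tendsto (fun t : ℝ => 2 * t) (𝓝[>] 0) (𝓝[>] 0) := by
    refine tendsto_nhdsWithin_iff.2 ⟨?_, ?_⟩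
    · have : Tendsto (fun t : ℝ => 2 * t) (𝓝 0) (𝓝 (2 * 0)) :=
        tendsto_id.const_mul 2
      rw [mul_zero] at this
      exact this.mono_left nhdsWithin_le_nhds
    · filter_upwards [self_mem_nhdsWithin] with t (ht : 0 < t)
      exact mul_pos two_pos ht
  refine le_of_tendsto_of_tendsto (tendsto_normDirDeriv d (v + w))
    (((tendsto_normDirDeriv d v).comp h2).add ((tendsto_normDirDeriv d w).comp h2)) ?_
  filter_upwards [self_mem_nhdsWithin] with t (ht : 0 < t)
  have h3 : (2 : ℝ) * ‖d + t • (v + w)‖ ≤ ‖d + (2 * t) • v‖ + ‖d + (2 * t) • w‖ := by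
    calc (2 : ℝ) * ‖d + t • (v + w)‖ = ‖(2 : ℝ) • (d + t • (v + w))‖ := by
          rw [norm_smul, Real.norm_of_nonneg zero_le_two]
      _ = ‖(d + (2 * t) • v) + (d + (2 * t) • w)‖ := by congr 1; module
      _ ≤ _ := norm_add_le _ _
  simp only [Function.comp_apply]
  rw [← add_div, div_le_div_iff₀ ht (by positivity)]
  nlinarith

/-- If two directions give the same derivative of the norm at `d`, then `d` minimises the norm
on the line through `d` in the direction of their difference. -/
theorem norm_le_norm_add_smul_sub {d v w : V} (h : normDirDeriv d v = normDirDeriv d w) (t : ℝ) :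
    ‖d‖ ≤ ‖d + t • (v - w)‖ := by
  have key : ∀ {a b : V}, normDirDeriv d a = normDirDeriv d b → ∀ s : ℝ, 0 < s →
      ‖d‖ ≤ ‖d + s • (a - b)‖ := by
    intro a b hab s hs
    have h1 := normDirDeriv_add_le d (a - b) b
    rw [sub_add_cancel] at h1
    have h2 := normDirDeriv_le d (a - b) hs
    have h3 : 0 ≤ (‖d + s • (a - b)‖ - ‖d‖) / s := by linarith
    rw [le_div_iff₀ hs] at h3
    linarith
  rcases lt_trichotomy t 0 with ht | rfl | ht
  · have := key h.symm (-t) (by linarith)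
    rwa [neg_smul, ← smul_neg, neg_sub] at this
  · simp
  · exact key h t ht

/-- At a nonzero vector whose direction is smooth, the directional derivative of the norm is
the support functional. -/
theorem normDirDeriv_eq_of_suppFn_eq_singleton [FiniteDimensional ℝ V] {d : V} (hd : d ≠ 0)
    {g : V →L[ℝ] ℝ} (hg : suppFn V (unitDir d) = {g}) (v : V) : normDirDeriv d v = g v := by
  have hd' : 0 < ‖d‖ := norm_pos_iff.2 hd
  have hmem : ∀ k : V →L[ℝ] ℝ, k ∈ suppFn V (unitDir d) ↔ ‖k‖ = 1 ∧ k d = ‖d‖ := by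
    intro k
    simp only [suppFn, unitDir, mem_ofPred_eq, map_smul, smul_eq_mul, inv_mul_eq_one₀ hd'.ne',
      eq_comm (a := ‖d‖)]
  have hle : ∀ (k : V →L[ℝ] ℝ), ‖k‖ = 1 → ∀ x, k x ≤ ‖x‖ := fun k hk x => by
    simpa [hk] using (le_abs_self _).trans (k.le_opNorm x)
  obtain ⟨hg1, hgd⟩ := (hmem g).1 (hg ▸ mem_singleton g)
  have ht : ∀ n : ℕ, (0 : ℝ) < 1 / (n + 1) := fun n => Nat.one_div_pos_of_nat
  have ht0 : Tendsto (fun n : ℕ => (1 : ℝ) / (n + 1)) atTop (𝓝 0) :=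
    tendsto_one_div_add_atTop_nhds_zero_nat
  have hlim := tendsto_normDirDeriv_seq d ht ht0 (tendsto_const_nhds (x := v))
  have : Nontrivial V := ⟨⟨d, 0, hd⟩⟩
  choose k hk1 hkd using fun n : ℕ => exists_dual_vector' ℝ (d + (1 / ((n : ℝ) + 1)) • v)
  simp only [RCLike.ofReal_real_eq_id, id_eq] at hkd
  obtain ⟨k₀, hk₀, φ, hφ, hkφ⟩ := (isCompact_sphere (0 : V →L[ℝ] ℝ) 1).tendsto_subseq
    (x := k) (fun n => by simpa using hk1 n)
  have hev : ∀ x, Tendsto (fun n => k (φ n) x) atTop (𝓝 (k₀ x)) := fun x =>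
    ((ContinuousLinearMap.apply ℝ ℝ x).continuous.tendsto k₀).comp hkφ
  have hpt : Tendsto (fun n => d + (1 / ((φ n : ℝ) + 1)) • v) atTop (𝓝 d) := by
    simpa using tendsto_const_nhds.add ((ht0.comp hφ.tendsto_atTop).smul_const v)
  have hk₀d : k₀ d = ‖d‖ := by
    have h1 : Tendsto (fun n => k (φ n) d + (1 / ((φ n : ℝ) + 1)) * k (φ n) v) atTop
        (𝓝 (k₀ d + 0 * k₀ v)) :=
      (hev d).add ((ht0.comp hφ.tendsto_atTop).mul (hev v))
    rw [zero_mul, add_zero] at h1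
    refine tendsto_nhds_unique h1 (hpt.norm.congr fun n => ?_)
    rw [← hkd (φ n), map_add, map_smul, smul_eq_mul]
  have hk₀g : k₀ = g := by
    have : k₀ ∈ suppFn V (unitDir d) := (hmem k₀).2 ⟨by simpa using hk₀, hk₀d⟩
    rwa [hg] at this
  refine le_antisymm ?_ ?_
  · rw [← hk₀g]
    refine le_of_tendsto_of_tendsto' (hlim.comp hφ.tendsto_atTop) (hev v) fun n => ?_
    have h1 := hkd (φ n)
    rw [map_add, map_smul, smul_eq_mul] at h1
    have h2 := hle _ (hk1 (φ n)) d
    rw [Function.comp_apply, div_le_iff₀ (ht _)]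
    linarith
  · refine ge_of_tendsto' hlim fun n => ?_
    have h1 := hle g hg1 (d + (1 / ((n : ℝ) + 1)) • v)
    rw [map_add, map_smul, smul_eq_mul] at h1
    rw [le_div_iff₀ (ht _)]
    linarith

/-- From a point `q` of the unit sphere, every direction that enters the open ball at the
midpoint `q + d / 2` meets the sphere again. -/
theorem exists_pos_norm_add_smul_eq_one {q d : V} (hd : d ≠ 0)
    (h : ‖q + (1 / 2 : ℝ) • d‖ < 1) : ∃ s : ℝ, 0 < s ∧ ‖q + s • d‖ = 1 := by
  have hd' : 0 < ‖d‖ := norm_pos_iff.2 hd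
  set T : ℝ := 1 / 2 + (1 + ‖q‖) / ‖d‖ with hT
  have hT2 : 1 / 2 ≤ T := le_add_of_nonneg_right (by positivity)
  have h1 : 1 ≤ ‖q + T • d‖ := by
    have h2 : ‖T • d‖ ≤ ‖q + T • d‖ + ‖q‖ := by
      simpa using norm_sub_le (q + T • d) q
    rw [norm_smul, Real.norm_of_nonneg (by linarith), hT, add_mul, div_mul_cancel₀ _ hd'.ne'] at h2
    linarith
  obtain ⟨s, hs, hs1⟩ := intermediate_value_Icc hT2
    (f := fun s : ℝ => ‖q + s • d‖) (by fun_prop) ⟨h.le, h1⟩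
  exact ⟨s, by linarith [hs.1], hs1⟩

/-- A direction is determined by the derivatives of the norm along it at the vectors `p - q`,
where `q` is fixed and `p` runs over the rest of the unit sphere. -/
theorem eq_of_normDirDeriv_sub_eq {q v w : V} (hq : ‖q‖ = 1)
    (h : ∀ p, ‖p‖ = 1 → p ≠ q → normDirDeriv (p - q) v = normDirDeriv (p - q) w) : v = w := by
  have key : ∀ t : ℝ, ‖q + t • (v - w)‖ < 2 → ‖q + (-t) • (v - w)‖ = 1 := by
    intro t ht
    set d : V := -q + t • (v - w) with hd
    have hd0 : d ≠ 0 := by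
      intro h0
      have : t • (v - w) = q := by rw [hd, neg_add_eq_zero] at h0; exact h0.symm
      rw [this, ← two_smul ℝ q, norm_smul, hq] at ht
      norm_num at ht
    have hmid : ‖q + (1 / 2 : ℝ) • d‖ < 1 := by
      have : q + (1 / 2 : ℝ) • d = (1 / 2 : ℝ) • (q + t • (v - w)) := by rw [hd]; module
      rw [this, norm_smul, Real.norm_of_nonneg (by norm_num)]
      linarith
    obtain ⟨s, hs, hs1⟩ := exists_pos_norm_add_smul_eq_one hd0 hmid
    have hmin := norm_le_norm_add_smul_sub
      (h (q + s • d) hs1 (by simpa using ⟨hs.ne', hd0⟩)) (-(s * t))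
    have h1 : q + s • d - q + (-(s * t)) • (v - w) = s • (-q) := by rw [hd]; module
    rw [h1, add_sub_cancel_left, norm_smul, norm_smul, norm_neg, hq] at hmin
    have h2 : ‖d‖ ≤ 1 := le_of_mul_le_mul_left hmin (norm_pos_iff.2 hs.ne')
    have h3 : ‖q + (-t) • (v - w)‖ = ‖d‖ := by
      rw [← norm_neg, hd]; congr 1; module
    rw [h3]
    refine le_antisymm h2 ?_
    have h4 := norm_le_norm_add_smul_sub (h (-q) (by rwa [norm_neg]) ?_) (2 * t)
    · have h5 : -q - q + (2 * t) • (v - w) = (2 : ℝ) • d := by rw [hd]; module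
      have h6 : -q - q = (-2 : ℝ) • q := by module
      rw [h5, h6, norm_smul, norm_smul, hq] at h4
      norm_num at h4
      exact h4
    · intro h0
      have h5 : (2 : ℝ) • q = 0 := by rw [two_smul]; nth_rewrite 1 [← h0]; exact neg_add_cancel q
      rw [(smul_eq_zero_iff_right two_ne_zero).1 h5, norm_zero] at hq
      exact zero_ne_one hq
  by_contra hvw
  have hw : 0 < ‖v - w‖ := norm_pos_iff.2 (sub_ne_zero.2 hvw)
  have hT : (3 / 2 : ℝ) ≤ ‖q + (3 / ‖v - w‖) • (v - w)‖ := by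
    have h2 : ‖(3 / ‖v - w‖) • (v - w)‖ ≤ ‖q + (3 / ‖v - w‖) • (v - w)‖ + ‖q‖ := by
      simpa using norm_sub_le (q + (3 / ‖v - w‖) • (v - w)) q
    rw [norm_smul, Real.norm_of_nonneg (by positivity), div_mul_cancel₀ _ hw.ne', hq] at h2
    linarith
  obtain ⟨t, -, ht⟩ := intermediate_value_Icc (a := (0 : ℝ)) (b := 3 / ‖v - w‖) (by positivity)
    (f := fun t : ℝ => ‖q + t • (v - w)‖) (by fun_prop)
    (show (3 / 2 : ℝ) ∈ _ from ⟨by simp [hq]; norm_num, hT⟩)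
  simp only at ht
  have h1 := key t (by rw [ht]; norm_num)
  have h2 := key (-t) (by rw [h1]; norm_num)
  rw [neg_neg, ht] at h2
  norm_num at h2

theorem norm_smul_unitDir (v : V) : ‖v‖ • unitDir v = v := by
  rcases eq_or_ne v 0 with rfl | hv
  · simp
  · rw [unitDir, smul_inv_smul₀ (norm_ne_zero_iff.2 hv)]

theorem norm_unitDir_s5 {v : V} (hv : v ≠ 0) : ‖unitDir v‖ = 1 := by
  rw [unitDir, norm_smul, norm_inv, norm_norm, inv_mul_cancel₀ (norm_ne_zero_iff.2 hv)]

/-- Difference quotients of the distance to `x` along a sequence of points approaching `y`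
tangentially to `u`. -/
theorem tendsto_dist_quotient {x y u : V} {z : ℕ → V} (hz : ∀ n, z n ≠ y)
    (hzy : Tendsto (fun n => ‖y - z n‖) atTop (𝓝 0))
    (hu : Tendsto (fun n => unitDir (y - z n)) atTop (𝓝 u)) :
    Tendsto (fun n => (‖x - z n‖ - ‖x - y‖) / ‖y - z n‖) atTop (𝓝 (normDirDeriv (x - y) u)) := by
  refine (tendsto_normDirDeriv_seq (x - y)
    (fun n => norm_pos_iff.2 (sub_ne_zero.2 (hz n).symm)) hzy hu).congr fun n => ?_
  rw [norm_smul_unitDir, sub_add_sub_cancel]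

end NormDirDeriv

/-- **Lemma 4.** If `y_n → y` on the sphere and `(y - y_n)/‖y - y_n‖` converges, then
`(f y - f y_n)/‖f y - f y_n‖` converges as well; moreover, for every `x ∈ W_y`,
`⟨γ((x-y)/‖x-y‖), lim (y-y_n)/‖y-y_n‖⟩ = ⟨γ((f x - f y)/‖f x - f y‖), lim (f y - f y_n)/‖f y - f y_n‖⟩`. -/
theorem lemma4 {X E : Type*} [NormedAddCommGroup X] [NormedSpace ℝ X]
    [FiniteDimensional ℝ X] [NormedAddCommGroup E] [NormedSpace ℝ E] [FiniteDimensional ℝ E]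
    (f : X → E) (hbij : Set.BijOn f (sphere (0 : X) 1) (sphere (0 : E) 1))
    (hiso : ∀ x ∈ sphere (0 : X) 1, ∀ x' ∈ sphere (0 : X) 1, ‖f x - f x'‖ = ‖x - x'‖)
    (y : X) (hy : y ∈ sphere (0 : X) 1)
    (yn : ℕ → X) (hyn : ∀ n, yn n ∈ sphere (0 : X) 1 ∧ yn n ≠ y)
    (hconv : Tendsto yn atTop (𝓝 y))
    (u : X) (hu : Tendsto (fun n => unitDir (y - yn n)) atTop (𝓝 u)) :
    ∃ v : E, Tendsto (fun n => unitDir (f y - f (yn n))) atTop (𝓝 v) ∧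
      ∀ x ∈ Wset f y, ∀ (gX : X →L[ℝ] ℝ) (gE : E →L[ℝ] ℝ),
        suppFn X (unitDir (x - y)) = {gX} → suppFn E (unitDir (f x - f y)) = {gE} →
        gX u = gE v := by
  have hne : ∀ {x}, x ∈ sphere (0 : X) 1 → x ≠ y → f x ≠ f y := fun hx hxy h =>
    hxy (hbij.injOn hx hy h)
  have hdist : Tendsto (fun n => ‖y - yn n‖) atTop (𝓝 0) := by
    simpa using (hconv.const_sub y).norm
  have hmem : ∀ n, unitDir (f y - f (yn n)) ∈ sphere (0 : E) 1 := fun n => by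
    rw [mem_sphere_zero_iff_norm]
    exact norm_unitDir_s5 (sub_ne_zero.2 (hne (hyn n).1 (hyn n).2).symm)
  have hsub : ∀ {φ : ℕ → ℕ} {v : E}, StrictMono φ →
      Tendsto ((fun n => unitDir (f y - f (yn n))) ∘ φ) atTop (𝓝 v) →
      ∀ x ∈ sphere (0 : X) 1, normDirDeriv (f x - f y) v = normDirDeriv (x - y) u := by
    intro φ v hφ hv x hx
    have h1 := tendsto_dist_quotient (x := x) (fun n => (hyn (φ n)).2)
      (hdist.comp hφ.tendsto_atTop) (hu.comp hφ.tendsto_atTop)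
    have h2 := tendsto_dist_quotient (x := f x) (fun n => hne (hyn (φ n)).1 (hyn (φ n)).2)
      ((hdist.comp hφ.tendsto_atTop).congr fun n => (hiso y hy _ (hyn (φ n)).1).symm) hv
    refine tendsto_nhds_unique h2 (h1.congr fun n => ?_)
    rw [hiso x hx _ (hyn (φ n)).1, hiso x hx y hy, hiso y hy _ (hyn (φ n)).1]
  obtain ⟨v, -, φ, hφ, hv⟩ := (isCompact_sphere (0 : E) 1).tendsto_subseq hmem
  refine ⟨v, ?_, ?_⟩
  · refine (isCompact_sphere (0 : E) 1).tendsto_nhds_of_unique_mapClusterPt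
      (Eventually.of_forall hmem) fun w _ hw => ?_
    obtain ⟨ψ, hψ, hw'⟩ := hw.tendsto_subseq
    refine eq_of_normDirDeriv_sub_eq (q := f y) (by simpa using hbij.mapsTo hy) fun p hp _ => ?_
    obtain ⟨x, hx, rfl⟩ := hbij.surjOn (show p ∈ sphere (0 : E) 1 by simpa using hp)
    rw [hsub hψ hw' x hx, hsub hφ hv x hx]
  · rintro x ⟨⟨hx, hxy⟩, -, -⟩ gX gE hgX hgE
    have hxne : x ≠ y := by
      rintro rfl
      rw [← two_smul ℝ x, norm_smul, mem_sphere_zero_iff_norm.1 hx] at hxy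
      norm_num at hxy
    rw [← normDirDeriv_eq_of_suppFn_eq_singleton (sub_ne_zero.2 hxne) hgX,
      ← normDirDeriv_eq_of_suppFn_eq_singleton (sub_ne_zero.2 (hne hx hxne)) hgE,
      hsub hφ hv x hx]
end
end
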